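/- arXiv:2205.06738 — 3 statements merged into one kernel-verified Lean document; each statement's English description precedes it below -/
import Mathlib

section
/- Let m, n be positive integers and let A be a real m×n matrix of rank r = αn for some 0 < α < 1. Suppose A is (k,D)-ℓ₂-RIP for some k ≥ 1 and D ≥ 1, and fix η > 0 such that C₁·D⁸/(1−α)⁴ ≤ n^η ≤ C₂·k³/(D⁴n²), where C₁, C₂ are suitable universal positive constants. Then there exists a submatrix T ∈ ℝ^{t×n} consisting of t ≤ m rows of A such that: (1) ‖T‖_F² / ‖A‖_F² ≥ n^{−η}; (2) t ≥ c₁·k³/(D⁴n^{2+η}) for a universal constant c₁ > 0; and (3) every row x of T satisfies Δ_{1,2}(x) ≤ c₂·(D³n/(η·√(1−α)·log n))^{1/2} for a universal constant c₂ > 0. -/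
open Finset

/-- The ℓ_p norm of a vector `x`, `‖x‖_p = (∑ i, |x i|^p)^(1/p)`. -/
noncomputable def pNorm (p : ℝ) {ι : Type*} [Fintype ι] (x : ι → ℝ) : ℝ :=
  (∑ i, |x i| ^ p) ^ (1 / p)

/-- The (ℓ_q, ℓ_p)-distortion of a vector `x ∈ ℝⁿ`:
`Δ_{q,p}(x) = ‖x‖_p · n^(1/q - 1/p) / ‖x‖_q`. -/
noncomputable def distortion (q p : ℝ) {ι : Type*} [Fintype ι] (x : ι → ℝ) : ℝ :=
  pNorm p x * (Fintype.card ι : ℝ) ^ (1 / q - 1 / p) / pNorm q x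

/-- A vector is `k`-sparse if it has at most `k` nonzero entries. -/
def IsSparse (k : ℝ) {ι : Type*} [Fintype ι] (x : ι → ℝ) : Prop :=
  ((Finset.univ.filter (fun i => x i ≠ 0)).card : ℝ) ≤ k

/-- A matrix `A` is `(k, D)`-ℓ_p-RIP if there is `K > 0` with
`K‖x‖_p ≤ ‖Ax‖_p ≤ D·K‖x‖_p` for every `k`-sparse `x`. -/
def IsRIP (p : ℝ) {ι κ : Type*} [Fintype ι] [Fintype κ] (A : Matrix ι κ ℝ) (k D : ℝ) : Prop :=
  ∃ K > 0, ∀ x : κ → ℝ, IsSparse k x →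
    K * pNorm p x ≤ pNorm p (A.mulVec x) ∧ pNorm p (A.mulVec x) ≤ D * K * pNorm p x

/-- A matrix `A ∈ ℝ^{m×n}` is `(k, D)`-ℓ₂-ARIP if there is `K > 0` with
`K‖x‖₂ ≤ ‖Ax‖₂ ≤ D·K‖x‖₂` for every `x` with `Δ_{1,2}(x) ≥ (n/k)^(1/2)`. -/
def IsARIP {ι κ : Type*} [Fintype ι] [Fintype κ] (A : Matrix ι κ ℝ) (k D : ℝ) : Prop :=
  ∃ K > 0, ∀ x : κ → ℝ, ((Fintype.card κ : ℝ) / k) ^ ((1 : ℝ) / 2) ≤ distortion 1 2 x →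
    K * pNorm 2 x ≤ pNorm 2 (A.mulVec x) ∧ pNorm 2 (A.mulVec x) ≤ D * K * pNorm 2 x

/-- The Frobenius norm of a matrix. -/
noncomputable def frobNorm {ι κ : Type*} [Fintype ι] [Fintype κ] (A : Matrix ι κ ℝ) : ℝ :=
  Real.sqrt (∑ i, ∑ j, (A i j) ^ 2)

/-- The ℓ₁ norm as a plain sum. -/
noncomputable def l1 {ι : Type*} [Fintype ι] (x : ι → ℝ) : ℝ := ∑ i, |x i|

/-- The Euclidean norm as the square root of a plain sum. -/
noncomputable def l2 {ι : Type*} [Fintype ι] (x : ι → ℝ) : ℝ := Real.sqrt (∑ i, x i ^ 2)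

section Norms

variable {ι : Type*} [Fintype ι]

theorem l1_nonneg (x : ι → ℝ) : 0 ≤ l1 x := sum_nonneg fun _ _ => abs_nonneg _

theorem l2_nonneg (x : ι → ℝ) : 0 ≤ l2 x := Real.sqrt_nonneg _

theorem l2_sq (x : ι → ℝ) : l2 x ^ 2 = ∑ i, x i ^ 2 :=
  Real.sq_sqrt (sum_nonneg fun _ _ => sq_nonneg _)

theorem l2_eq_norm (x : ι → ℝ) : l2 x = ‖WithLp.toLp 2 x‖ := by
  simp [l2, EuclideanSpace.norm_eq]

theorem l2_zero : l2 (0 : ι → ℝ) = 0 := by simp [l2]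

theorem l2_add_le (x y : ι → ℝ) : l2 (x + y) ≤ l2 x + l2 y := by
  simp only [l2_eq_norm, WithLp.toLp_add]
  exact norm_add_le _ _

theorem l2_smul (c : ℝ) (x : ι → ℝ) : l2 (c • x) = |c| * l2 x := by
  simp only [l2_eq_norm, WithLp.toLp_smul, norm_smul, Real.norm_eq_abs]

theorem l1_smul (c : ℝ) (x : ι → ℝ) : l1 (c • x) = |c| * l1 x := by
  simp [l1, abs_mul, mul_sum]

theorem l1_add_le (x y : ι → ℝ) : l1 (x + y) ≤ l1 x + l1 y := by
  rw [l1, l1, l1, ← sum_add_distrib]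
  exact sum_le_sum fun i _ => abs_add_le _ _

theorem dotProduct_le_l2 (x y : ι → ℝ) : x ⬝ᵥ y ≤ l2 x * l2 y :=
  Real.sum_mul_le_sqrt_mul_sqrt _ _ _

theorem dotProduct_self_eq_l2 (x : ι → ℝ) : x ⬝ᵥ x = l2 x ^ 2 := by
  rw [l2_sq]; exact sum_congr rfl fun i _ => (sq _).symm

theorem l2_sq_le_of_abs_le {x : ι → ℝ} {c : ℝ} (h : ∀ i, |x i| ≤ c) :
    l2 x ^ 2 ≤ c * l1 x := by
  rw [l2_sq, l1, mul_sum]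
  refine sum_le_sum fun i _ => ?_
  rw [← sq_abs, sq]
  exact mul_le_mul_of_nonneg_right (h i) (abs_nonneg _)

theorem l2_le_l1 (x : ι → ℝ) : l2 x ≤ l1 x := by
  refine le_of_sq_le_sq ?_ (l1_nonneg x)
  rw [sq (l1 x)]
  exact l2_sq_le_of_abs_le fun i =>
    single_le_sum (f := fun j => |x j|) (fun _ _ => abs_nonneg _) (mem_univ i)

theorem l1_sq_le (x : ι → ℝ) : l1 x ^ 2 ≤ Fintype.card ι * l2 x ^ 2 := by
  have := sq_sum_le_card_mul_sum_sq (s := (univ : Finset ι)) (f := fun i => |x i|)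
  simpa [l1, l2_sq] using this

theorem pNorm_two (x : ι → ℝ) : pNorm 2 x = l2 x := by
  simp [pNorm, l2, Real.sqrt_eq_rpow]

theorem pNorm_one (x : ι → ℝ) : pNorm 1 x = l1 x := by
  simp [pNorm, l1]

end Norms

section Sparse

variable {ι μ : Type*} [Fintype ι] [Fintype μ]

theorem exists_top_subset (f : ι → ℝ) (s : Finset ι) (k : ℕ) (hk : k ≤ s.card) :
    ∃ S ⊆ s, S.card = k ∧ ∃ c, (∀ i ∈ S, c ≤ f i) ∧ ∀ j ∈ s, j ∉ S → f j ≤ c := by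
  classical
  induction k with
  | zero =>
    refine ⟨∅, by simp, by simp, ∑ i, |f i|, by simp, fun j _ _ => ?_⟩
    exact (le_abs_self _).trans
      (single_le_sum (f := fun j => |f j|) (fun _ _ => abs_nonneg _) (mem_univ j))
  | succ k ih =>
    obtain ⟨S, hSs, hcard, c, hc1, hc2⟩ := ih (by omega)
    have hne : (s \ S).Nonempty := by
      rw [← card_pos, card_sdiff_of_subset hSs]; omega
    obtain ⟨a, ha, hmax⟩ := exists_max_image (s \ S) f hne
    rw [mem_sdiff] at ha
    refine ⟨insert a S, insert_subset ha.1 hSs, by rw [card_insert_of_notMem ha.2, hcard],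
      f a, ?_, ?_⟩
    · intro i hi
      rcases mem_insert.1 hi with rfl | hi
      · exact le_rfl
      · exact (hc2 a ha.1 ha.2).trans (hc1 i hi)
    · intro j hj hjn
      rw [mem_insert, not_or] at hjn
      exact hmax j (mem_sdiff.2 ⟨hj, hjn.2⟩)

theorem l1_indicator_add (S : Finset ι) (x : ι → ℝ) :
    l1 ((S : Set ι).indicator x) + l1 (x - (S : Set ι).indicator x) = l1 x := by
  classical
  rw [l1, l1, l1, ← sum_add_distrib]
  refine sum_congr rfl fun i _ => ?_
  by_cases h : i ∈ S <;> simp [h]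

theorem card_mul_le_l1_indicator {S : Finset ι} {x : ι → ℝ} {c : ℝ}
    (h : ∀ i ∈ S, c ≤ |x i|) : S.card * c ≤ l1 ((S : Set ι).indicator x) := by
  classical
  calc S.card * c = ∑ i ∈ S, c := by simp
    _ ≤ ∑ i ∈ S, |x i| := sum_le_sum h
    _ = l1 ((S : Set ι).indicator x) := by
      simp [l1, Set.indicator_apply, abs_ite]

theorem card_support_indicator_le (S : Finset ι) (x : ι → ℝ) :
    (univ.filter fun i => (S : Set ι).indicator x i ≠ 0).card ≤ S.card := by
  classical
  refine card_le_card fun i hi => ?_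
  by_contra h
  simp [h] at hi

variable {A : Matrix μ ι ℝ} {k : ℕ} {D : ℝ}

theorem l2_mulVec_le_of_abs_le (hk : 0 < k) (hD : 0 ≤ D)
    (hA : ∀ x : ι → ℝ, (univ.filter fun i => x i ≠ 0).card ≤ k →
      l2 (A.mulVec x) ≤ D * l2 x) (N : ℕ) :
    ∀ (x : ι → ℝ) (c : ℝ), (univ.filter fun i => x i ≠ 0).card ≤ N → 0 ≤ c →
      (∀ i, |x i| ≤ c) → l2 (A.mulVec x) ≤ D * (√k * c + l1 x / √k) := by
  classical
  have hkpos : (0 : ℝ) < k := by exact_mod_cast hk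
  have hsk : 0 < √(k : ℝ) := Real.sqrt_pos.2 hkpos
  have hss : √(k : ℝ) * √k = k := Real.mul_self_sqrt hkpos.le
  have sparse_case : ∀ (x : ι → ℝ) (c : ℝ), (univ.filter fun i => x i ≠ 0).card ≤ k → 0 ≤ c →
      (∀ i, |x i| ≤ c) → l2 (A.mulVec x) ≤ D * (√k * c) := by
    intro x c hx hc hxc
    refine (hA x hx).trans (mul_le_mul_of_nonneg_left ?_ hD)
    refine le_of_sq_le_sq ?_ (by positivity)
    rw [l2_sq, mul_pow, Real.sq_sqrt hkpos.le]
    calc ∑ i, x i ^ 2 = ∑ i ∈ univ.filter (fun i => x i ≠ 0), x i ^ 2 := by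
          rw [sum_filter_of_ne]; intro i _ h h'; simp [h'] at h
      _ ≤ ∑ i ∈ univ.filter (fun i => x i ≠ 0), c ^ 2 :=
          sum_le_sum fun i _ => sq_le_sq.2 (by rw [abs_of_nonneg hc]; exact hxc i)
      _ ≤ k * c ^ 2 := by
          rw [sum_const, nsmul_eq_mul]
          exact mul_le_mul_of_nonneg_right (by exact_mod_cast hx) (sq_nonneg _)
  induction N with
  | zero =>
    intro x c hx hc hxc
    refine (sparse_case x c (hx.trans (Nat.zero_le _)) hc hxc).trans ?_
    have := div_nonneg (l1_nonneg x) hsk.le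
    gcongr; linarith
  | succ N ih =>
    intro x c hx hc hxc
    by_cases hxk : (univ.filter fun i => x i ≠ 0).card ≤ k
    · refine (sparse_case x c hxk hc hxc).trans ?_
      have := div_nonneg (l1_nonneg x) hsk.le
      gcongr; linarith
    obtain ⟨S, hS, hcard, c', h1, h2⟩ :=
      exists_top_subset (fun i => |x i|) (univ.filter fun i => x i ≠ 0) k (by omega)
    have hSk := card_mul_le_l1_indicator h1
    rw [hcard] at hSk
    have hrest : ∀ i, |(x - (S : Set ι).indicator x) i| ≤ max c' 0 := by
      intro i
      by_cases hi : i ∈ S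
      · simp [hi]
      · by_cases h0 : x i = 0
        · simp [hi, h0]
        · simpa [hi] using Or.inl (h2 i (by simp [h0]) hi)
    have hSk' : k * max c' 0 ≤ l1 ((S : Set ι).indicator x) := by
      rcases max_cases c' 0 with ⟨h, _⟩ | ⟨h, _⟩ <;> rw [h]
      · exact hSk
      · simpa using l1_nonneg _
    have hN : (univ.filter fun i => (x - (S : Set ι).indicator x) i ≠ 0).card ≤ N := by
      have : (univ.filter fun i => (x - (S : Set ι).indicator x) i ≠ 0) ⊆
          (univ.filter fun i => x i ≠ 0) \ S := by
        intro i hi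
        by_cases h : i ∈ S
        · simp [h] at hi
        · simpa [h] using hi
      have h3 := card_le_card this
      rw [card_sdiff_of_subset hS] at h3
      omega
    have h4 := ih _ _ hN (le_max_right _ _) hrest
    have h5 := sparse_case ((S : Set ι).indicator x) c
      ((card_support_indicator_le S x).trans hcard.le) hc (by
        intro i
        by_cases h : i ∈ S
        · simpa [h] using hxc i
        · simpa [h] using hc)
    have h6 : A.mulVec x = A.mulVec ((S : Set ι).indicator x) +
        A.mulVec (x - (S : Set ι).indicator x) := by
      rw [← Matrix.mulVec_add]; congr 1; abel
    rw [h6]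
    refine (l2_add_le _ _).trans ((add_le_add h5 h4).trans ?_)
    rw [← mul_add]
    refine mul_le_mul_of_nonneg_left ?_ hD
    rw [← l1_indicator_add S x, add_div]
    have : √(k : ℝ) * max c' 0 ≤ l1 ((S : Set ι).indicator x) / √k := by
      rw [le_div_iff₀ hsk, mul_right_comm, hss]; exact hSk'
    linarith

theorem exists_sparse_part (hk : 0 < k) (hD : 0 ≤ D)
    (hA : ∀ x : ι → ℝ, (univ.filter fun i => x i ≠ 0).card ≤ k →
      l2 (A.mulVec x) ≤ D * l2 x) (x : ι → ℝ) :
    ∃ y z : ι → ℝ, x = y + z ∧ (univ.filter fun i => y i ≠ 0).card ≤ k ∧ l2 y ≤ l2 x ∧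
      l2 (A.mulVec z) ≤ D * (l1 x / √k) ∧ l2 z ≤ l1 x / √k := by
  classical
  have hkpos : (0 : ℝ) < k := by exact_mod_cast hk
  have hsk : 0 < √(k : ℝ) := Real.sqrt_pos.2 hkpos
  have hss : √(k : ℝ) * √k = k := Real.mul_self_sqrt hkpos.le
  by_cases hxk : (univ.filter fun i => x i ≠ 0).card ≤ k
  · refine ⟨x, 0, by simp, hxk, le_rfl, ?_, ?_⟩
    · rw [Matrix.mulVec_zero, l2_zero]
      exact mul_nonneg hD (div_nonneg (l1_nonneg x) hsk.le)
    · rw [l2_zero]; exact div_nonneg (l1_nonneg x) hsk.le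
  obtain ⟨S, hS, hcard, c, h1, h2⟩ :=
    exists_top_subset (fun i => |x i|) univ k
      ((not_le.1 hxk).le.trans (card_le_card (filter_subset _ _)))
  have hSk := card_mul_le_l1_indicator h1
  rw [hcard] at hSk
  have hrest : ∀ i, |(x - (S : Set ι).indicator x) i| ≤ max c 0 := by
    intro i
    by_cases hi : i ∈ S
    · simp [hi]
    · simpa [hi] using Or.inl (h2 i (mem_univ i) hi)
  have hSk' : k * max c 0 ≤ l1 ((S : Set ι).indicator x) := by
    rcases max_cases c 0 with ⟨h, _⟩ | ⟨h, _⟩ <;> rw [h]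
    · exact hSk
    · simpa using l1_nonneg _
  have hadd := l1_indicator_add S x
  have hn1 := l1_nonneg ((S : Set ι).indicator x)
  have hn2 := l1_nonneg (x - (S : Set ι).indicator x)
  refine ⟨(S : Set ι).indicator x, x - (S : Set ι).indicator x, by abel,
    (card_support_indicator_le S x).trans hcard.le, ?_, ?_, ?_⟩
  · refine Real.sqrt_le_sqrt (sum_le_sum fun i _ => ?_)
    by_cases h : i ∈ S <;> simp [h, sq_nonneg]
  · refine (l2_mulVec_le_of_abs_le hk hD hA _ _ _ le_rfl (le_max_right c 0) hrest).trans
      (mul_le_mul_of_nonneg_left ?_ hD)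
    rw [← hadd, add_div]
    have : √(k : ℝ) * max c 0 ≤ l1 ((S : Set ι).indicator x) / √k := by
      rw [le_div_iff₀ hsk, mul_right_comm, hss]; exact hSk'
    linarith
  · refine le_of_sq_le_sq ?_ (div_nonneg (l1_nonneg x) hsk.le)
    refine (l2_sq_le_of_abs_le hrest).trans ?_
    rw [div_pow, Real.sq_sqrt hkpos.le, le_div_iff₀ hkpos, ← hadd]
    nlinarith [le_max_right c 0]

theorem l2_mulVec_le (hk : 0 < k) (hD : 0 ≤ D)
    (hA : ∀ x : ι → ℝ, (univ.filter fun i => x i ≠ 0).card ≤ k →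
      l2 (A.mulVec x) ≤ D * l2 x) (x : ι → ℝ) :
    l2 (A.mulVec x) ≤ D * (l2 x + l1 x / √k) := by
  obtain ⟨y, z, hxyz, hy, hyx, hAz, -⟩ := exists_sparse_part hk hD hA x
  conv_lhs => rw [hxyz, Matrix.mulVec_add]
  refine (l2_add_le _ _).trans ?_
  nlinarith [hA y hy, mul_le_mul_of_nonneg_left hyx hD]

theorem le_l2_mulVec (hk : 0 < k) (hD : 1 ≤ D)
    (hA : ∀ x : ι → ℝ, (univ.filter fun i => x i ≠ 0).card ≤ k →
      l2 x ≤ l2 (A.mulVec x) ∧ l2 (A.mulVec x) ≤ D * l2 x) (x : ι → ℝ) :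
    l2 x - 2 * D * (l1 x / √k) ≤ l2 (A.mulVec x) := by
  obtain ⟨y, z, hxyz, hy, -, hAz, hz⟩ :=
    exists_sparse_part hk (zero_le_one.trans hD) (fun x hx => (hA x hx).2) x
  have h1 : l2 x ≤ l2 y + l2 z := by
    conv_lhs => rw [hxyz]
    exact l2_add_le _ _
  have h2 : l2 (A.mulVec y) ≤ l2 (A.mulVec x) + l2 (A.mulVec z) := by
    have : A.mulVec y = A.mulVec x + (-1 : ℝ) • A.mulVec z := by
      conv_rhs => rw [hxyz, Matrix.mulVec_add]
      module
    rw [this]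
    refine (l2_add_le _ _).trans ?_
    rw [l2_smul]; simp
  have h3 := (hA y hy).1
  have h4 := div_nonneg (l1_nonneg x) (Real.sqrt_nonneg (k : ℝ))
  nlinarith

end Sparse

section Descent

variable {ι μ : Type*} [Fintype ι] [Fintype μ]

/-- One gradient step for `x ↦ ‖Bx‖²` restricted to the coordinates in `G`. -/
theorem exists_descent_step {B : Matrix μ ι ℝ} {G : Finset ι} {D L r : ℝ} (hD : 1 ≤ D)
    (hup : ∀ x : ι → ℝ, l2 (B.mulVec x) ≤ D * (l2 x + l1 x * r)) (hr : 0 ≤ r)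
    (hcol : ∀ j ∈ G, ∑ i, |B i j| * l1 (B i) ≤ L)
    {x : ι → ℝ} (hx : ∀ j ∉ G, x j = 0) (hlow : l2 x / 2 ≤ l2 (B.mulVec x))
    (hflat : L * l1 x * r ≤ D * l2 x) :
    ∃ x' : ι → ℝ, (∀ j ∉ G, x' j = 0) ∧ l1 x' ≤ (1 + L / (4 * D ^ 2)) * l1 x ∧
      (∀ v : ι → ℝ, (∀ j ∉ G, v j = 0) → B.mulVec v = 0 → x' ⬝ᵥ v = x ⬝ᵥ v) ∧
      l2 x' ^ 2 ≤ (1 - 1 / (16 * D ^ 2)) * l2 x ^ 2 := by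
  classical
  set y := B.mulVec x with hy
  set g : ι → ℝ := fun j => if j ∈ G then (B.transpose.mulVec y) j else 0 with hg
  have hgG : ∀ j ∉ G, g j = 0 := fun j hj => by simp [hg, hj]
  have hgv : ∀ v : ι → ℝ, (∀ j ∉ G, v j = 0) → g ⬝ᵥ v = y ⬝ᵥ B.mulVec v := by
    intro v hv
    rw [Matrix.dotProduct_mulVec, ← Matrix.mulVec_transpose]
    refine sum_congr rfl fun j _ => ?_
    by_cases hj : j ∈ G
    · simp [hg, hj]
    · simp [hv j hj]
  have hg1 : l1 g ≤ L * l1 x := by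
    have hyi : ∀ i, |y i| ≤ ∑ l, |B i l| * |x l| := fun i => by
      simp only [hy, Matrix.mulVec, dotProduct]
      exact (abs_sum_le_sum_abs _ _).trans_eq (sum_congr rfl fun _ _ => abs_mul _ _)
    calc l1 g ≤ ∑ j, ∑ i, |B i j| * |y i| := by
          refine sum_le_sum fun j _ => ?_
          by_cases hj : j ∈ G
          · simp only [hg, hj, if_true, Matrix.mulVec, dotProduct, Matrix.transpose_apply]
            exact (abs_sum_le_sum_abs _ _).trans_eq (sum_congr rfl fun _ _ => abs_mul _ _)
          · simp only [hg, hj, if_false, abs_zero]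
            positivity
      _ = ∑ i, l1 (B i) * |y i| := by
          rw [sum_comm]; exact sum_congr rfl fun i _ => by rw [l1, sum_mul]
      _ ≤ ∑ i, l1 (B i) * ∑ l, |B i l| * |x l| :=
          sum_le_sum fun i _ => mul_le_mul_of_nonneg_left (hyi i) (l1_nonneg _)
      _ = ∑ l, (∑ i, |B i l| * l1 (B i)) * |x l| := by
          simp only [mul_sum, sum_mul]
          rw [sum_comm]
          exact sum_congr rfl fun _ _ => sum_congr rfl fun _ _ => by ring
      _ ≤ ∑ l, L * |x l| := by
          refine sum_le_sum fun l _ => ?_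
          by_cases hl : l ∈ G
          · exact mul_le_mul_of_nonneg_right (hcol l hl) (abs_nonneg _)
          · simp [hx l hl]
      _ = L * l1 x := by rw [l1, mul_sum]
  have hy0 := l2_nonneg y
  have hg2 : l2 g ≤ 2 * D * l2 y := by
    by_cases hc : l2 g ≤ l1 g * r
    · have := mul_le_mul_of_nonneg_right hg1 hr
      nlinarith
    · rw [not_le] at hc
      have h1 : l2 g ^ 2 ≤ l2 y * (D * (l2 g + l1 g * r)) := by
        rw [← dotProduct_self_eq_l2, hgv g hgG]
        exact (dotProduct_le_l2 _ _).trans (mul_le_mul_of_nonneg_left (hup g) hy0)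
      have hgpos : 0 < l2 g := (mul_nonneg (l1_nonneg g) hr).trans_lt hc
      have h2 : l2 y * (D * (l2 g + l1 g * r)) ≤ l2 y * (D * (2 * l2 g)) := by
        gcongr; linarith
      refine le_of_mul_le_mul_right ?_ hgpos
      nlinarith
  refine ⟨x + (-(1 / (4 * D ^ 2))) • g, ?_, ?_, ?_, ?_⟩
  · intro j hj
    simp [hx j hj, hgG j hj]
  · refine (l1_add_le _ _).trans ?_
    rw [l1_smul, abs_neg, abs_of_pos (by positivity)]
    have := mul_le_mul_of_nonneg_left hg1 (show 0 ≤ 1 / (4 * D ^ 2) by positivity)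
    calc l1 x + 1 / (4 * D ^ 2) * l1 g ≤ l1 x + 1 / (4 * D ^ 2) * (L * l1 x) := by linarith
      _ = _ := by ring
  · intro v hv hBv
    rw [add_dotProduct, smul_dotProduct, hgv v hv, hBv, dotProduct_zero]
    simp
  · have hxg : x ⬝ᵥ g = l2 y ^ 2 := by
      rw [dotProduct_comm, hgv x hx, ← hy, dotProduct_self_eq_l2]
    have hexp : l2 (x + (-(1 / (4 * D ^ 2))) • g) ^ 2 =
        l2 x ^ 2 - 2 * (1 / (4 * D ^ 2)) * l2 y ^ 2 + (1 / (4 * D ^ 2)) ^ 2 * l2 g ^ 2 := by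
      rw [← dotProduct_self_eq_l2, add_dotProduct, dotProduct_add, dotProduct_add,
        smul_dotProduct, smul_dotProduct, dotProduct_smul, dotProduct_smul, dotProduct_comm g x,
        hxg, dotProduct_self_eq_l2, dotProduct_self_eq_l2]
      simp only [smul_eq_mul]; ring
    have h1 : l2 g ^ 2 ≤ (2 * D * l2 y) ^ 2 := pow_le_pow_left₀ (l2_nonneg g) hg2 2
    have h2 : (l2 x / 2) ^ 2 ≤ l2 y ^ 2 :=
      pow_le_pow_left₀ (div_nonneg (l2_nonneg x) zero_le_two) hlow 2
    have h3 := mul_le_mul_of_nonneg_left h1 (sq_nonneg (1 / (4 * D ^ 2)))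
    have h4 := mul_le_mul_of_nonneg_left h2 (show 0 ≤ 1 / (4 * D ^ 2) by positivity)
    have h5 : (1 / (4 * D ^ 2)) ^ 2 * (2 * D * l2 y) ^ 2 = 1 / (4 * D ^ 2) * l2 y ^ 2 := by
      field_simp; ring
    have h6 : 1 / (4 * D ^ 2) * (l2 x / 2) ^ 2 = 1 / (16 * D ^ 2) * l2 x ^ 2 := by
      field_simp; ring
    rw [hexp]
    linarith

theorem exists_descent {B : Matrix μ ι ℝ} {G : Finset ι} {D L r U θ : ℝ} (hD : 1 ≤ D)
    (hL : 0 ≤ L) (hr : 0 ≤ r)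
    (hup : ∀ x : ι → ℝ, l2 (B.mulVec x) ≤ D * (l2 x + l1 x * r))
    (hcol : ∀ j ∈ G, ∑ i, |B i j| * l1 (B i) ≤ L)
    (hlow : ∀ x : ι → ℝ, (∀ j ∉ G, x j = 0) → l1 x ≤ U → θ ≤ l2 x → l2 x / 2 ≤ l2 (B.mulVec x))
    (hflat : 4 * D * U * r ≤ θ) {v : ι → ℝ} (hv : ∀ j ∉ G, v j = 0) (hBv : B.mulVec v = 0)
    {j : ι} (hj : j ∈ G) (hvj : v j = l2 v ^ 2) (hv0 : 0 < l2 v) (hθv : θ ≤ l2 v) (t : ℕ) :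
    (1 + L / (4 * D ^ 2)) ^ t ≤ U →
    ∃ x : ι → ℝ, (∀ j ∉ G, x j = 0) ∧ l1 x ≤ (1 + L / (4 * D ^ 2)) ^ t ∧
      θ ≤ l2 x ∧ x ⬝ᵥ v = l2 v ^ 2 ∧ l2 x ^ 2 ≤ (1 - 1 / (16 * D ^ 2)) ^ t := by
  classical
  have hge : ∀ x : ι → ℝ, x ⬝ᵥ v = l2 v ^ 2 → θ ≤ l2 x := by
    intro x hx
    have := dotProduct_le_l2 x v
    rw [hx, sq] at this
    exact hθv.trans (le_of_mul_le_mul_right this hv0)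
  have hb : 1 ≤ 1 + L / (4 * D ^ 2) := by
    have : 0 ≤ L / (4 * D ^ 2) := by positivity
    linarith
  induction t with
  | zero =>
    intro _
    have hdot : Pi.single j (1 : ℝ) ⬝ᵥ v = l2 v ^ 2 := by simp [hvj]
    refine ⟨Pi.single j 1, ?_, ?_, hge _ hdot, hdot, ?_⟩
    · intro i hi
      have : i ≠ j := fun h => hi (h ▸ hj)
      simp [this]
    · simp [l1, Pi.single_apply, abs_ite]
    · simp [l2_sq, Pi.single_apply]
  | succ t ih =>
    intro hU
    have hU' : (1 + L / (4 * D ^ 2)) ^ t ≤ U :=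
      (pow_le_pow_right₀ hb (Nat.le_succ t)).trans hU
    obtain ⟨x, hx, hx1, hxθ, hxv, hx2⟩ := ih hU'
    have hfl : L * l1 x * r ≤ D * l2 x := by
      have hLx : L * l1 x ≤ 4 * D ^ 2 * U := by
        calc L * l1 x ≤ 4 * D ^ 2 * ((1 + L / (4 * D ^ 2)) * l1 x) := by
              have h : 4 * D ^ 2 * ((1 + L / (4 * D ^ 2)) * l1 x) =
                  4 * D ^ 2 * l1 x + L * l1 x := by field_simp
              rw [h]
              have := mul_nonneg (show 0 ≤ 4 * D ^ 2 by positivity) (l1_nonneg x)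
              linarith
          _ ≤ 4 * D ^ 2 * (1 + L / (4 * D ^ 2)) ^ (t + 1) := by
              rw [pow_succ' (1 + L / (4 * D ^ 2)) t]; gcongr
          _ ≤ 4 * D ^ 2 * U := by gcongr
      calc L * l1 x * r ≤ 4 * D ^ 2 * U * r := by gcongr
        _ = D * (4 * D * U * r) := by ring
        _ ≤ D * l2 x := by gcongr; exact hflat.trans hxθ
    obtain ⟨x', h1, h2, h3, h4⟩ := exists_descent_step hD hup hr hcol hx
      (hlow x hx (hx1.trans hU') hxθ) hfl
    have hdot : x' ⬝ᵥ v = l2 v ^ 2 := (h3 v hv hBv).trans hxv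
    refine ⟨x', h1, h2.trans ?_, hge _ hdot, hdot, h4.trans ?_⟩
    · rw [pow_succ' (1 + L / (4 * D ^ 2)) t]; gcongr
    · rw [pow_succ' (1 - 1 / (16 * D ^ 2)) t]
      have : 1 / (16 * D ^ 2) ≤ 1 := by
        rw [div_le_one (by positivity)]; nlinarith
      exact mul_le_mul_of_nonneg_left hx2 (by linarith)

end Descent

section Counting

theorem card_filter_lt_mul_le {ι : Type*} [Fintype ι] (f : ι → ℝ) (hf : ∀ i, 0 ≤ f i) (c : ℝ) :
    ((univ.filter fun i => c < f i).card : ℝ) * c ≤ ∑ i, f i := by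
  calc ((univ.filter fun i => c < f i).card : ℝ) * c
      = ∑ i ∈ univ.filter fun i => c < f i, c := by simp
    _ ≤ ∑ i ∈ univ.filter fun i => c < f i, f i :=
        sum_le_sum fun i hi => (mem_filter.1 hi).2.le
    _ ≤ ∑ i, f i := sum_le_sum_of_subset_of_nonneg (filter_subset _ _) fun i _ _ => hf i

/-- A subspace of dimension `d` contains a vector `v` with `v j = ‖v‖² ≥ d / n` for some `j`. -/
theorem exists_mem_coord_eq {n : ℕ} (hn : 0 < n) (V : Submodule ℝ (EuclideanSpace ℝ (Fin n))) :
    ∃ v ∈ V, ∃ j, v j = ‖v‖ ^ 2 ∧ (Module.finrank ℝ V : ℝ) / n ≤ ‖v‖ ^ 2 := by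
  set b := stdOrthonormalBasis ℝ V
  have hn' : (0 : ℝ) < n := by exact_mod_cast hn
  have hsum : ∑ j : Fin n, (Module.finrank ℝ V : ℝ) / n ≤
      ∑ j : Fin n, ∑ i, ((b i : EuclideanSpace ℝ (Fin n)) j) ^ 2 := by
    rw [sum_comm]
    have : ∀ i, ∑ j, ((b i : EuclideanSpace ℝ (Fin n)) j) ^ 2 = 1 := fun i => by
      have h := b.orthonormal.1 i
      rw [Submodule.coe_norm, EuclideanSpace.norm_eq, Real.sqrt_eq_one] at h
      simpa using h
    simp only [this]
    simp only [sum_const, card_univ, Fintype.card_fin, nsmul_eq_mul, mul_one]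
    rw [mul_div_cancel₀ _ hn'.ne']
  obtain ⟨j, -, hj⟩ := exists_le_of_sum_le (s := (univ : Finset (Fin n)))
    ⟨⟨0, hn⟩, mem_univ _⟩ hsum
  set w : V := ∑ i, ((b i : EuclideanSpace ℝ (Fin n)) j) • b i with hw
  have hnorm : ‖(w : EuclideanSpace ℝ (Fin n))‖ ^ 2 =
      ∑ i, ((b i : EuclideanSpace ℝ (Fin n)) j) ^ 2 := by
    rw [← Submodule.coe_norm, ← real_inner_self_eq_norm_sq, hw, b.orthonormal.inner_sum]
    simp [sq]
  refine ⟨w, w.2, j, ?_, by rw [hnorm]; exact hj⟩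
  rw [hnorm, hw]
  simp [sq]

theorem exists_ker_vector {m n : ℕ} (hn : 0 < n) (A : Matrix (Fin m) (Fin n) ℝ)
    (G : Finset (Fin n)) (β : ℝ) (hβ : 0 < β) (hG : A.rank + ((Gᶜ).card : ℝ) + β * n ≤ n) :
    ∃ v : Fin n → ℝ, (∀ j ∉ G, v j = 0) ∧ A.mulVec v = 0 ∧ ∃ j ∈ G, v j = l2 v ^ 2 ∧
      β ≤ l2 v ^ 2 := by
  classical
  set F : EuclideanSpace ℝ (Fin n) →ₗ[ℝ] (Fin n → ℝ) :=
    (WithLp.linearEquiv 2 ℝ (Fin n → ℝ)).toLinearMap with hF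
  set K := LinearMap.ker (A.mulVecLin ∘ₗ F)
  set R : EuclideanSpace ℝ (Fin n) →ₗ[ℝ] ((Gᶜ : Finset (Fin n)) → ℝ) :=
    (LinearMap.funLeft ℝ ℝ (fun j : (Gᶜ : Finset (Fin n)) => (j : Fin n))) ∘ₗ F
  have hK : A.rank + Module.finrank ℝ K = n := by
    have h := LinearMap.finrank_range_add_finrank_ker (A.mulVecLin ∘ₗ F)
    rw [LinearMap.range_comp_of_range_eq_top _ (LinearEquiv.range _)] at h
    simpa [Matrix.rank] using h
  have hR : n ≤ (Gᶜ).card + Module.finrank ℝ (LinearMap.ker R) := by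
    have h := LinearMap.finrank_range_add_finrank_ker R
    have h2 := Submodule.finrank_le (LinearMap.range R)
    simp only [finrank_euclideanSpace, Fintype.card_fin, Module.finrank_fintype_fun_eq_card,
      Fintype.card_coe] at h h2
    omega
  have hsup := Submodule.finrank_sup_add_finrank_inf_eq K (LinearMap.ker R)
  have hle := Submodule.finrank_le (K ⊔ LinearMap.ker R)
  rw [finrank_euclideanSpace, Fintype.card_fin] at hle
  have hdim : n ≤ Module.finrank ℝ ↥(K ⊓ LinearMap.ker R) + (Gᶜ).card + A.rank := by omega
  obtain ⟨v, hv, j, hvj, hvn⟩ := exists_mem_coord_eq hn (K ⊓ LinearMap.ker R)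
  have hn' : (0 : ℝ) < n := by exact_mod_cast hn
  have hβv : β ≤ ‖v‖ ^ 2 := by
    refine le_trans ?_ hvn
    rw [le_div_iff₀ hn']
    have : (n : ℝ) ≤ Module.finrank ℝ ↥(K ⊓ LinearMap.ker R) + (Gᶜ).card + A.rank := by
      exact_mod_cast hdim
    linarith
  have hvG : ∀ i ∉ G, v i = 0 := by
    intro i hi
    exact congrFun (LinearMap.mem_ker.1 hv.2) ⟨i, mem_compl.2 hi⟩
  have hl2 : l2 (WithLp.ofLp v) = ‖v‖ := by rw [l2_eq_norm]
  refine ⟨WithLp.ofLp v, hvG, LinearMap.mem_ker.1 hv.1, j, ?_, by rw [hl2]; exact hvj,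
    by rw [hl2]; exact hβv⟩
  by_contra hj
  rw [hvG j hj] at hvj
  linarith

end Counting

section Rows

variable {ι μ : Type*} [Fintype ι]

/-- The matrix `A` with all rows outside `S` replaced by zero. -/
def keepRows [DecidableEq μ] (S : Finset μ) (A : Matrix μ ι ℝ) : Matrix μ ι ℝ :=
  Matrix.of fun i j => if i ∈ S then A i j else 0

theorem keepRows_mulVec [DecidableEq μ] (S : Finset μ) (A : Matrix μ ι ℝ) (x : ι → ℝ) (i : μ) :
    (keepRows S A).mulVec x i = if i ∈ S then A.mulVec x i else 0 := by
  by_cases h : i ∈ S <;> simp [keepRows, Matrix.mulVec, dotProduct, h]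

variable [Fintype μ]

theorem l2_sq_keepRows_add [DecidableEq μ] (S : Finset μ) (A : Matrix μ ι ℝ) (x : ι → ℝ) :
    l2 ((keepRows S A).mulVec x) ^ 2 + l2 ((keepRows Sᶜ A).mulVec x) ^ 2 =
      l2 (A.mulVec x) ^ 2 := by
  rw [l2_sq, l2_sq, l2_sq, ← sum_add_distrib]
  refine sum_congr rfl fun i _ => ?_
  by_cases h : i ∈ S <;> simp [keepRows_mulVec, h]

theorem l2_mulVec_le_l1_mul {A : Matrix μ ι ℝ} {x : ι → ℝ} {c : ℝ}
    (h : ∀ j, x j = 0 ∨ l2 (fun i => A i j) ≤ c) : l2 (A.mulVec x) ≤ l1 x * c := by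
  have hsum : A.mulVec x = ∑ j, x j • fun i => A i j := by
    ext i
    simp [Matrix.mulVec, dotProduct, Finset.sum_apply, mul_comm]
  rw [hsum, l2_eq_norm, WithLp.toLp_sum, l1, sum_mul]
  refine (norm_sum_le _ _).trans (sum_le_sum fun j _ => ?_)
  rw [← l2_eq_norm, l2_smul]
  rcases h j with h | h
  · simp [h]
  · exact mul_le_mul_of_nonneg_left h (abs_nonneg _)

theorem l2_col_mem_Icc [DecidableEq ι] {A : Matrix μ ι ℝ} {k : ℕ} {D : ℝ} (hk : 0 < k)
    (hA : ∀ x : ι → ℝ, (univ.filter fun i => x i ≠ 0).card ≤ k →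
      l2 x ≤ l2 (A.mulVec x) ∧ l2 (A.mulVec x) ≤ D * l2 x) (j : ι) :
    1 ≤ l2 (fun i => A i j) ∧ l2 (fun i => A i j) ≤ D := by
  have h := hA (Pi.single j 1) (by
    refine le_trans ?_ (Nat.succ_le_of_lt hk)
    refine (card_le_card (t := {j}) fun i hi => ?_).trans_eq (card_singleton j)
    by_contra hij
    simp_all)
  have h1 : l2 (Pi.single j (1 : ℝ)) = 1 := by simp [l2, Pi.single_apply]
  have h2 : A.mulVec (Pi.single j 1) = fun i => A i j := by
    ext i; simp
  rwa [h1, h2, mul_one] at h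

theorem sum_l2_sq_comm (A : Matrix μ ι ℝ) :
    ∑ i, l2 (A i) ^ 2 = ∑ j, l2 (fun i => A i j) ^ 2 := by
  simp only [l2_sq]
  exact sum_comm

theorem sum_l2_sq_mem_Icc {A : Matrix μ ι ℝ} {k : ℕ} {D : ℝ} (hk : 0 < k)
    (hA : ∀ x : ι → ℝ, (univ.filter fun i => x i ≠ 0).card ≤ k →
      l2 x ≤ l2 (A.mulVec x) ∧ l2 (A.mulVec x) ≤ D * l2 x) :
    Fintype.card ι ≤ ∑ i, l2 (A i) ^ 2 ∧ ∑ i, l2 (A i) ^ 2 ≤ Fintype.card ι * D ^ 2 := by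
  classical
  rw [sum_l2_sq_comm]
  constructor
  · calc (Fintype.card ι : ℝ) = ∑ _j : ι, (1 : ℝ) := by simp
      _ ≤ _ := sum_le_sum fun j _ => one_le_pow₀ (l2_col_mem_Icc hk hA j).1
  · calc ∑ j, l2 (fun i => A i j) ^ 2 ≤ ∑ _j : ι, D ^ 2 :=
        sum_le_sum fun j _ => pow_le_pow_left₀ (l2_nonneg _) (l2_col_mem_Icc hk hA j).2 2
      _ = _ := by simp

theorem l2_row_sq_le {A : Matrix μ ι ℝ} {k : ℕ} {D : ℝ} (hk : 0 < k) (hkn : k ≤ Fintype.card ι)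
    (hD : 0 ≤ D) (hA : ∀ x : ι → ℝ, (univ.filter fun i => x i ≠ 0).card ≤ k →
      l2 (A.mulVec x) ≤ D * l2 x) (i : μ) :
    l2 (A i) ^ 2 * k ≤ 4 * D ^ 2 * Fintype.card ι := by
  have hkpos : (0 : ℝ) < k := by exact_mod_cast hk
  set q := √(Fintype.card ι : ℝ) with hq
  have hqk : √(k : ℝ) ≤ q := Real.sqrt_le_sqrt (by exact_mod_cast hkn)
  have hl1 : l1 (A i) ≤ q * l2 (A i) := by
    refine le_of_sq_le_sq ?_ (mul_nonneg (Real.sqrt_nonneg _) (l2_nonneg _))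
    rw [mul_pow, Real.sq_sqrt (Nat.cast_nonneg _)]
    exact l1_sq_le _
  have h1 : l2 (A i) ^ 2 ≤ l2 (A.mulVec (A i)) := by
    rw [← dotProduct_self_eq_l2]
    refine le_of_sq_le_sq ?_ (l2_nonneg _)
    rw [l2_sq]
    exact single_le_sum (f := fun i' => (A.mulVec (A i) i') ^ 2) (fun _ _ => sq_nonneg _)
      (mem_univ i)
  have h2 := l2_mulVec_le hk hD hA (A i)
  have hmul : l2 (A i) ^ 2 * √k ≤ 2 * D * q * l2 (A i) := by
    calc l2 (A i) ^ 2 * √k ≤ D * (l2 (A i) + l1 (A i) / √k) * √k := by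
          gcongr; exact h1.trans h2
      _ = D * (√k * l2 (A i) + l1 (A i)) := by field_simp
      _ ≤ D * (q * l2 (A i) + q * l2 (A i)) := by
          have := mul_le_mul_of_nonneg_right hqk (l2_nonneg (A i))
          gcongr
      _ = _ := by ring
  rcases (l2_nonneg (A i)).eq_or_lt with h0 | hpos
  · rw [← h0]; simp; positivity
  · have h3 : l2 (A i) * √k ≤ 2 * D * q := by
      refine le_of_mul_le_mul_right ?_ hpos
      nlinarith
    have h4 := pow_le_pow_left₀ (by positivity) h3 2
    rw [mul_pow, mul_pow, mul_pow, Real.sq_sqrt hkpos.le, Real.sq_sqrt (Nat.cast_nonneg _)] at h4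
    linarith

end Rows

/-- All but few columns of `A` have a light part in `T` and small `ℓ₁`-overlap outside `T`. -/
theorem exists_good_columns {m n : ℕ} (hn : 0 < n) {A : Matrix (Fin m) (Fin n) ℝ}
    {D β s E : ℝ} (hD : 0 < D) (hβ : 0 < β) (hs : 0 < s) (hE : 0 < E)
    (hfrob : ∑ i, l2 (A i) ^ 2 ≤ n * D ^ 2)
    (T : Finset (Fin m)) (hT : ∀ i ∉ T, l1 (A i) ^ 2 ≤ s * l2 (A i) ^ 2)
    (hTE : E * ∑ i ∈ T, l2 (A i) ^ 2 < ∑ i, l2 (A i) ^ 2) :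
    ∃ G : Finset (Fin n), ((Gᶜ).card : ℝ) ≤ β * n / 2 ∧ ∀ l ∈ G,
      ∑ i, |keepRows Tᶜ A i l| * l1 (keepRows Tᶜ A i) ≤ 4 * s * D ^ 2 / β ∧
      l2 (fun i => keepRows T A i l) ^ 2 ≤ 4 * D ^ 2 / (E * β) := by
  classical
  set B := keepRows Tᶜ A with hB
  set C := keepRows T A with hC
  set L := 4 * s * D ^ 2 / β with hL
  set τ := 4 * D ^ 2 / (E * β) with hτ
  have hL0 : 0 < L := by positivity
  have hτ0 : 0 < τ := by positivity
  have hBrow : ∀ i, B i = if i ∈ T then 0 else A i := by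
    intro i; ext j; by_cases h : i ∈ T <;> simp [hB, keepRows, h]
  have hCrow : ∀ i, C i = if i ∈ T then A i else 0 := by
    intro i; ext j; by_cases h : i ∈ T <;> simp [hC, keepRows, h]
  set bad₁ := univ.filter fun j => L < ∑ i, |B i j| * l1 (B i)
  set bad₂ := univ.filter fun j => τ < l2 (fun i => C i j) ^ 2
  have hbad₁ : (bad₁.card : ℝ) ≤ β * n / 4 := by
    have h1 : (bad₁.card : ℝ) * L ≤ s * (n * D ^ 2) := by
      refine (card_filter_lt_mul_le _
        (fun j => sum_nonneg fun i _ => mul_nonneg (abs_nonneg _) (l1_nonneg _)) L).trans ?_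
      rw [sum_comm]
      calc ∑ i, ∑ j, |B i j| * l1 (B i) = ∑ i, l1 (B i) ^ 2 :=
            sum_congr rfl fun i _ => by rw [← sum_mul, sq]; rfl
        _ ≤ ∑ i, s * l2 (A i) ^ 2 := by
            refine sum_le_sum fun i _ => ?_
            rw [hBrow]
            by_cases h : i ∈ T
            · simp only [h, if_true]
              have : l1 (0 : Fin n → ℝ) = 0 := by simp [l1]
              rw [this, zero_pow two_ne_zero]; exact mul_nonneg hs.le (sq_nonneg _)
            · simpa only [h, if_false] using hT i h
        _ ≤ s * (n * D ^ 2) := by rw [← mul_sum]; gcongr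
    refine le_of_mul_le_mul_right (h1.trans_eq ?_) hL0
    rw [hL]; field_simp
  have hbad₂ : (bad₂.card : ℝ) ≤ β * n / 4 := by
    have h1 : (bad₂.card : ℝ) * τ ≤ n * D ^ 2 / E := by
      refine (card_filter_lt_mul_le _ (fun j => sq_nonneg _) τ).trans ?_
      rw [← sum_l2_sq_comm, le_div_iff₀' hE]
      refine le_trans ?_ (hTE.le.trans hfrob)
      rw [← sum_subset (subset_univ T) (f := fun i => l2 (C i) ^ 2)]
      · refine le_of_eq (congrArg _ (sum_congr rfl fun i hi => ?_))
        rw [hCrow]; simp [hi]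
      · intro i _ hi
        rw [hCrow]; simp [hi, l2_zero]
    refine le_of_mul_le_mul_right (h1.trans_eq ?_) hτ0
    rw [hτ]; field_simp
  set G := (bad₁ ∪ bad₂)ᶜ with hG
  have hGcard : ((Gᶜ).card : ℝ) ≤ β * n / 2 := by
    have : ((Gᶜ).card : ℝ) ≤ bad₁.card + bad₂.card := by
      rw [hG, compl_compl]; exact_mod_cast card_union_le _ _
    linarith
  refine ⟨G, hGcard, fun l hl => ?_⟩
  simpa [hG, bad₁, bad₂] using hl

theorem half_le_l2_keepRows_compl {m n : ℕ} {A : Matrix (Fin m) (Fin n) ℝ}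
    {T : Finset (Fin m)} {G : Finset (Fin n)} {τ : ℝ} (hτ : 0 ≤ τ)
    (hG : ∀ l ∈ G, l2 (fun i => keepRows T A i l) ^ 2 ≤ τ) {x : Fin n → ℝ}
    (hx : ∀ j ∉ G, x j = 0) (hxτ : l1 x ^ 2 * τ ≤ 1 / 4 * l2 x ^ 2)
    (hA : 3 / 4 * l2 x ≤ l2 (A.mulVec x)) :
    l2 x / 2 ≤ l2 ((keepRows Tᶜ A).mulVec x) := by
  have h2 : l2 ((keepRows T A).mulVec x) ≤ l1 x * √τ := by
    refine l2_mulVec_le_l1_mul fun l => ?_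
    by_cases hl : l ∈ G
    · exact Or.inr (Real.le_sqrt_of_sq_le (hG l hl))
    · exact Or.inl (hx l hl)
  have h3 : l2 ((keepRows T A).mulVec x) ^ 2 ≤ 1 / 4 * l2 x ^ 2 := by
    calc l2 ((keepRows T A).mulVec x) ^ 2 ≤ (l1 x * √τ) ^ 2 :=
          pow_le_pow_left₀ (l2_nonneg _) h2 2
      _ = l1 x ^ 2 * τ := by rw [mul_pow, Real.sq_sqrt hτ]
      _ ≤ 1 / 4 * l2 x ^ 2 := hxτ
  have h4 := l2_sq_keepRows_add T A x
  have h5 := pow_le_pow_left₀ (mul_nonneg (by norm_num) (l2_nonneg x)) hA 2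
  refine le_of_sq_le_sq ?_ (l2_nonneg _)
  linarith [sq_nonneg (l2 x)]

/-- If all rows outside `T` have small `ℓ₁/ℓ₂` ratio, then `T` carries a proportion at least
`1 / E` of the Frobenius mass. -/
theorem sum_le_mul_sum_of_flat_rows {m n : ℕ} (hn : 0 < n) {A : Matrix (Fin m) (Fin n) ℝ}
    {k t : ℕ} {D β s E U : ℝ} (hk : 0 < k) (hD : 1 ≤ D) (hβ : 0 < β) (hs : 0 < s) (hE : 0 < E)
    (hrank : A.rank + β * n = n)
    (hA : ∀ x : Fin n → ℝ, (univ.filter fun i => x i ≠ 0).card ≤ k →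
      l2 x ≤ l2 (A.mulVec x) ∧ l2 (A.mulVec x) ≤ D * l2 x)
    (T : Finset (Fin m)) (hT : ∀ i ∉ T, l1 (A i) ^ 2 ≤ s * l2 (A i) ^ 2)
    (hU : (1 + s / β) ^ t ≤ U) (ht : 16 * D ^ 2 * Real.log (2 / β) < t)
    (hUk : 128 * D ^ 2 * U ^ 2 ≤ k * β) (hUE : 32 * D ^ 2 * U ^ 2 ≤ E * β ^ 2) :
    ∑ i, l2 (A i) ^ 2 ≤ E * ∑ i ∈ T, l2 (A i) ^ 2 := by
  classical
  by_contra! hTE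
  have hkpos : (0 : ℝ) < k := by exact_mod_cast hk
  have hsk : 0 < √(k : ℝ) := Real.sqrt_pos.2 hkpos
  have hD0 : 0 < D := by linarith
  have hU0 : 0 ≤ U := le_trans (by positivity) hU
  have hfrob := (sum_l2_sq_mem_Icc hk hA).2
  rw [Fintype.card_fin] at hfrob
  obtain ⟨G, hGcard, hmemG⟩ := exists_good_columns hn hD0 hβ hs hE hfrob T hT hTE
  set B := keepRows Tᶜ A with hB
  set L := 4 * s * D ^ 2 / β with hL
  set τ := 4 * D ^ 2 / (E * β) with hτ
  have hL0 : 0 < L := by positivity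
  have hτ0 : 0 < τ := by positivity
  obtain ⟨v, hvG, hAv, j, hjG, hvj, hvβ⟩ :=
    exists_ker_vector hn A G (β / 2) (by positivity) (by linarith)
  set θ := √(β / 2) with hθ
  have hθsq : θ ^ 2 = β / 2 := Real.sq_sqrt (by positivity)
  have hθ0 : 0 < θ := Real.sqrt_pos.2 (by positivity)
  have hθv : θ ≤ l2 v := le_of_sq_le_sq (by rw [hθsq]; exact hvβ) (l2_nonneg v)
  have hBA : ∀ x, l2 (B.mulVec x) ≤ l2 (A.mulVec x) := fun x => by
    refine le_of_sq_le_sq ?_ (l2_nonneg _)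
    have := l2_sq_keepRows_add T A x
    nlinarith [sq_nonneg (l2 ((keepRows T A).mulVec x))]
  have hBv : B.mulVec v = 0 := by
    ext i
    rw [hB, keepRows_mulVec, hAv]; simp
  have hUθ : 8 * D * U * (1 / √k) ≤ θ := by
    rw [mul_one_div, div_le_iff₀ hsk]
    refine le_of_sq_le_sq ?_ (by positivity)
    rw [mul_pow θ, hθsq, Real.sq_sqrt hkpos.le]
    nlinarith
  have hLD : L / (4 * D ^ 2) = s / β := by rw [hL]; field_simp
  have hlow : ∀ x : Fin n → ℝ, (∀ j ∉ G, x j = 0) → l1 x ≤ U → θ ≤ l2 x →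
      l2 x / 2 ≤ l2 (B.mulVec x) := by
    intro x hx hx1 hx2
    have h1 : 3 / 4 * l2 x ≤ l2 (A.mulVec x) := by
      refine le_trans ?_ (le_l2_mulVec hk hD hA x)
      have : D * (l1 x / √k) ≤ D * (U * (1 / √k)) := by
        rw [mul_one_div]; gcongr
      linarith
    refine half_le_l2_keepRows_compl hτ0.le (fun l hl => (hmemG l hl).2) hx ?_ h1
    calc l1 x ^ 2 * τ ≤ U ^ 2 * τ := by
          gcongr; exact l1_nonneg x
      _ ≤ 1 / 4 * θ ^ 2 := by
          rw [hθsq, hτ, mul_div_assoc', div_le_iff₀ (by positivity)]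
          linarith only [hUE]
      _ ≤ 1 / 4 * l2 x ^ 2 := by gcongr
  obtain ⟨x, -, -, hxθ, -, hx2⟩ := exists_descent (B := B) (G := G) (D := D) (L := L)
    (r := 1 / √k) (U := U) (θ := θ) hD hL0.le (by positivity)
    (fun x => (hBA x).trans (by
      rw [mul_one_div]
      exact l2_mulVec_le hk hD0.le (fun x hx => (hA x hx).2) x))
    (fun l hl => (hmemG l hl).1) hlow (le_trans (by
      have : 0 ≤ D * U * (1 / √k) := by positivity
      linarith) hUθ) hvG hBv hjG hvj (hθ0.trans_le hθv) hθv t (by rw [hLD]; exact hU)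
  have h1 : β / 2 ≤ l2 x ^ 2 := by rw [← hθsq]; gcongr
  have h2 : (1 - 1 / (16 * D ^ 2)) ^ t ≤ Real.exp (-(t / (16 * D ^ 2))) := by
    have h16 : 1 / (16 * D ^ 2) ≤ 1 := by
      rw [div_le_one (by positivity)]; nlinarith
    calc (1 - 1 / (16 * D ^ 2)) ^ t ≤ Real.exp (-(1 / (16 * D ^ 2))) ^ t :=
          pow_le_pow_left₀ (by linarith) (Real.one_sub_le_exp_neg _) t
      _ = _ := by rw [← Real.exp_nat_mul]; congr 1; ring
  have h3 : Real.exp (-(t / (16 * D ^ 2))) < β / 2 := by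
    rw [← Real.lt_log_iff_exp_lt (by positivity), neg_lt, ← Real.log_inv, inv_div,
      lt_div_iff₀ (by positivity)]
    linarith
  linarith

theorem log_mul_log_le {N β D s : ℝ} (hβ : 0 < β) (hβ1 : β < 1) (hD : 1 ≤ D)
    (hs : s = N * √β / (10 ^ 12 * D ^ 3)) (hs1 : 1 ≤ s) :
    (16 * D ^ 2 * Real.log (2 / β) + 1) * Real.log (1 + s / β) ≤ N / 4 := by
  set b := √β with hb
  have hbb : b ^ 2 = β := Real.sq_sqrt hβ.le
  have hb0 : 0 < b := Real.sqrt_pos.2 hβ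
  have hD3 : 1 ≤ D ^ 3 := one_le_pow₀ hD
  have hND : 10 ^ 12 * D ^ 3 ≤ N * b := by
    rw [hs, le_div_iff₀ (by positivity), one_mul] at hs1
    exact hs1
  have hN0 : 0 < N := pos_of_mul_pos_left (lt_of_lt_of_le (by positivity) hND) hb0.le
  have hNb : N * b ≤ N := by nlinarith
  set u := N ^ ((1 : ℝ) / 6) with hu
  have hu0 : 0 < u := Real.rpow_pos_of_pos hN0 _
  have hu6 : u ^ 6 = N := by
    rw [hu, ← Real.rpow_natCast, ← Real.rpow_mul hN0.le]; norm_num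
  have hu100 : 100 ≤ u := by
    by_contra! h
    have := pow_lt_pow_left₀ h hu0.le (n := 6) (by norm_num)
    rw [hu6] at this
    linarith
  have hDu : D ≤ u ^ 2 / 10 ^ 4 := by
    by_contra! h
    have := pow_lt_pow_left₀ h (by positivity) (n := 3) (by norm_num)
    have h2 : (u ^ 2 / 10 ^ 4) ^ 3 = N / 10 ^ 12 := by rw [← hu6]; ring
    rw [h2] at this
    linarith
  have hinvb : 1 / b ≤ N / 10 ^ 12 := by
    rw [div_le_div_iff₀ hb0 (by norm_num)]; linarith
  have hinvβ : 1 / β ≤ (N / 10 ^ 12) ^ 2 := by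
    rw [← hbb, ← one_div_pow]
    exact pow_le_pow_left₀ (by positivity) hinvb 2
  have hsN : s ≤ N / 10 ^ 12 := by
    rw [hs, div_le_div_iff₀ (by positivity) (by norm_num)]
    nlinarith [mul_le_mul_of_nonneg_left hD3 hN0.le]
  have hlogN : Real.log (N ^ 3) ≤ 18 * u := by
    rw [← hu6, ← pow_mul, Real.log_pow]
    have := Real.log_le_sub_one_of_pos hu0
    push_cast
    linarith
  have h1 : Real.log (2 / β) ≤ 18 * u := by
    refine (Real.log_le_log (by positivity) ?_).trans hlogN
    have : 2 / β = 2 * (1 / β) := by ring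
    rw [this]
    nlinarith [sq_nonneg N]
  have h2 : Real.log (1 + s / β) ≤ 18 * u := by
    refine (Real.log_le_log (by positivity) ?_).trans hlogN
    have : s / β ≤ N / 10 ^ 12 * (N / 10 ^ 12) ^ 2 := by
      rw [div_eq_mul_one_div]; gcongr
    have h3 : 1 ≤ N ^ 2 * N := by nlinarith
    nlinarith
  have h3 : 0 ≤ Real.log (1 + s / β) := Real.log_nonneg (by
    have : 0 ≤ s / β := by positivity
    linarith)
  calc (16 * D ^ 2 * Real.log (2 / β) + 1) * Real.log (1 + s / β)
      ≤ (16 * (u ^ 2 / 10 ^ 4) ^ 2 * (18 * u) + 1) * (18 * u) := by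
        have : 16 * D ^ 2 * Real.log (2 / β) ≤ 16 * (u ^ 2 / 10 ^ 4) ^ 2 * (18 * u) := by
          calc 16 * D ^ 2 * Real.log (2 / β) ≤ 16 * D ^ 2 * (18 * u) := by gcongr
            _ ≤ _ := by gcongr
        gcongr
    _ ≤ N / 4 := by
        have h6 : 10 ^ 10 ≤ u ^ 5 := by
          calc (10 : ℝ) ^ 10 = 100 ^ 5 := by norm_num
            _ ≤ u ^ 5 := by gcongr
        have h7 : 10 ^ 10 * u ≤ u ^ 6 := by
          calc 10 ^ 10 * u ≤ u ^ 5 * u := by gcongr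
            _ = u ^ 6 := by ring
        have h8 : (16 * (u ^ 2 / 10 ^ 4) ^ 2 * (18 * u) + 1) * (18 * u) =
            5184 / 10 ^ 8 * u ^ 6 + 18 * u := by ring
        rw [h8, ← hu6]
        linarith

theorem distortion_one_two {n : ℕ} (x : Fin n → ℝ) :
    distortion 1 2 x = l2 x * √n / l1 x := by
  rw [distortion, pNorm_one, pNorm_two, Real.sqrt_eq_rpow]
  norm_num

theorem l1_sq_lt_of_lt_distortion {n : ℕ} {x : Fin n → ℝ} {c X : ℝ} (hc : 0 ≤ c) (hX : 0 ≤ X)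
    (h : c * X ^ ((1 : ℝ) / 2) < distortion 1 2 x) :
    c ^ 2 * X * l1 x ^ 2 < n * l2 x ^ 2 := by
  rw [distortion_one_two, ← Real.sqrt_eq_rpow] at h
  have hl : 0 < l1 x := by
    refine (l1_nonneg x).lt_of_ne' fun h0 => ?_
    rw [h0, div_zero] at h
    exact absurd h (not_lt.2 (by positivity))
  rw [lt_div_iff₀ hl] at h
  have h2 := pow_lt_pow_left₀ h (by positivity) two_ne_zero
  simp only [mul_pow, Real.sq_sqrt hX, Real.sq_sqrt (Nat.cast_nonneg n)] at h2
  linarith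

theorem frobNorm_sq {m n : ℕ} (A : Matrix (Fin m) (Fin n) ℝ) :
    frobNorm A ^ 2 = ∑ i, l2 (A i) ^ 2 := by
  simp only [l2_sq]
  exact Real.sq_sqrt (sum_nonneg fun _ _ => sum_nonneg fun _ _ => sq_nonneg _)

theorem lt_of_isRIP_of_rank {m n k : ℕ} (hn : 0 < n) {A : Matrix (Fin m) (Fin n) ℝ} {β : ℝ}
    (hβ : 0 < β) (hrank : A.rank + β * n = n)
    (hA : ∀ x : Fin n → ℝ, (univ.filter fun i => x i ≠ 0).card ≤ k →
      l2 x ≤ l2 (A.mulVec x)) : k < n := by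
  by_contra! hkn
  obtain ⟨v, -, hAv, -, -, -, hv⟩ := exists_ker_vector hn A univ β hβ (by simpa using hrank.le)
  have h := hA v ((card_le_univ _).trans (by simpa using hkn))
  rw [hAv, l2_zero] at h
  have h0 : l2 v = 0 := le_antisymm h (l2_nonneg v)
  rw [h0] at hv
  norm_num at hv
  linarith

/-- The rows of small distortion carry a proportion at least `1 / E` of the Frobenius mass. -/
theorem sum_le_mul_sum_of_ratio {m n k : ℕ} (hn : 0 < n) {A : Matrix (Fin m) (Fin n) ℝ}
    {D β s E : ℝ} (hk : 0 < k) (hD : 1 ≤ D) (hβ : 0 < β) (hβ1 : β < 1)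
    (hE : 10 ^ 6 * D ^ 8 / β ^ 4 ≤ E) (hEk : E ≤ 2 * k) (hrank : A.rank + β * n = n)
    (hA : ∀ x : Fin n → ℝ, (univ.filter fun i => x i ≠ 0).card ≤ k →
      l2 x ≤ l2 (A.mulVec x) ∧ l2 (A.mulVec x) ≤ D * l2 x)
    (hs : s = Real.log E * √β / (10 ^ 12 * D ^ 3))
    (T : Finset (Fin m)) (hT : ∀ i ∉ T, l1 (A i) ^ 2 < s * l2 (A i) ^ 2) :
    ∑ i, l2 (A i) ^ 2 ≤ E * ∑ i ∈ T, l2 (A i) ^ 2 := by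
  have hE0 : 0 < E := lt_of_lt_of_le (by positivity) hE
  rcases lt_or_ge s 1 with hs1 | hs1
  · have hTu : T = univ := by
      refine eq_univ_of_forall fun i => by_contra fun hi => ?_
      have h1 := hT i hi
      have h2 := pow_le_pow_left₀ (l2_nonneg (A i)) (l2_le_l1 (A i)) 2
      have h3 := mul_le_mul_of_nonneg_right hs1.le (sq_nonneg (l2 (A i)))
      linarith
    rw [hTu]
    have hE1 : 1 ≤ E := by
      refine le_trans ?_ hE
      rw [le_div_iff₀ (by positivity)]
      have := one_le_pow₀ hD (n := 8)
      have := pow_le_one₀ hβ.le hβ1.le (n := 4)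
      linarith
    exact le_mul_of_one_le_left (sum_nonneg fun _ _ => sq_nonneg _) hE1
  set W := √E with hW
  have hWE : W ^ 2 = E := Real.sq_sqrt hE0.le
  have hW0 : 0 < W := Real.sqrt_pos.2 hE0
  have hWlow : 1000 * D ^ 4 ≤ W * β ^ 2 := by
    rw [div_le_iff₀ (by positivity), ← hWE] at hE
    refine le_of_sq_le_sq ?_ (by positivity)
    linarith
  set U := Real.exp (Real.log E / 4) with hU
  have hUW : U ^ 2 = W := by
    rw [hU, hW, Real.sqrt_eq_rpow, Real.rpow_def_of_pos hE0, ← Real.exp_nat_mul]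
    congr 1; push_cast; ring
  have hD4 : D ^ 2 ≤ D ^ 4 := pow_le_pow_right₀ hD (by norm_num)
  have hββ : β ^ 2 ≤ β := by nlinarith
  have hWββ : W * β ^ 2 ≤ W * β := by gcongr
  have hlog : 0 ≤ 16 * D ^ 2 * Real.log (2 / β) := by
    have : 0 ≤ Real.log (2 / β) := Real.log_nonneg (by
      rw [le_div_iff₀ hβ]; linarith)
    positivity
  refine sum_le_mul_sum_of_flat_rows (t := ⌊16 * D ^ 2 * Real.log (2 / β)⌋₊ + 1) (U := U) hn hk
    hD hβ (by linarith) hE0 hrank hA T (fun i hi => (hT i hi).le) ?_ ?_ ?_ ?_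
  · rw [hU, ← Real.log_le_iff_le_exp (by positivity), Real.log_pow]
    refine le_trans ?_ (log_mul_log_le hβ hβ1 hD hs hs1)
    refine mul_le_mul_of_nonneg_right ?_ (Real.log_nonneg ?_)
    · push_cast
      linarith [Nat.floor_le hlog]
    · have : 0 < s / β := div_pos (by linarith) hβ
      linarith
  · push_cast
    exact Nat.lt_floor_add_one _
  · rw [hUW]
    have h1 : 256 * D ^ 2 ≤ W * β := by linarith [sq_nonneg D]
    calc 128 * D ^ 2 * W ≤ 1 / 2 * (W * β) * W :=
          mul_le_mul_of_nonneg_right (by linarith) hW0.le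
      _ = W ^ 2 / 2 * β := by ring
      _ ≤ k * β := by rw [hWE]; gcongr; linarith
  · rw [hUW, ← hWE]
    calc 32 * D ^ 2 * W ≤ W * β ^ 2 * W :=
          mul_le_mul_of_nonneg_right (by linarith [sq_nonneg D]) hW0.le
      _ = W ^ 2 * β ^ 2 := by ring

/-- **Theorem (ℓ₂-RIP matrices cannot be sparse).** There are universal positive constants
`C₁, C₂, c₁, c₂` such that the following holds. Let `A ∈ ℝ^{m×n}` have rank `αn` with
`0 < α < 1`, and suppose `A` is `(k, D)`-ℓ₂-RIP with `k ≥ 1`, `D ≥ 1`. If `η > 0` satisfies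
`C₁·D⁸/(1-α)⁴ ≤ n^η ≤ C₂·k³/(D⁴n²)`, then some submatrix `T` of `t ≤ m` rows of `A` satisfies:
(1) `‖T‖_F²/‖A‖_F² ≥ n^{-η}`; (2) `t ≥ c₁·k³/(D⁴n^{2+η})`; and (3) every row `x` of `T` has
`Δ_{1,2}(x) ≤ c₂·(D³n/(η√(1-α)·log n))^{1/2}`. -/
theorem ell2_rip_not_sparse :
    ∃ C₁ > (0 : ℝ), ∃ C₂ > (0 : ℝ), ∃ c₁ > (0 : ℝ), ∃ c₂ > (0 : ℝ),
      ∀ (m n : ℕ), 0 < m → 0 < n →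
        ∀ (A : Matrix (Fin m) (Fin n) ℝ) (α k D η : ℝ),
          0 < α → α < 1 → (A.rank : ℝ) = α * n →
          1 ≤ k → 1 ≤ D → IsRIP 2 A k D →
          0 < η →
          C₁ * D ^ 8 / (1 - α) ^ 4 ≤ (n : ℝ) ^ η →
          (n : ℝ) ^ η ≤ C₂ * k ^ 3 / (D ^ 4 * (n : ℝ) ^ 2) →
          ∃ (t : ℕ) (f : Fin t → Fin m), t ≤ m ∧ Function.Injective f ∧
            frobNorm (Matrix.of fun (i : Fin t) (j : Fin n) => A (f i) j) ^ 2
                / frobNorm A ^ 2 ≥ (n : ℝ) ^ (-η) ∧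
            (t : ℝ) ≥ c₁ * k ^ 3 / (D ^ 4 * (n : ℝ) ^ (2 + η)) ∧
            ∀ i : Fin t, distortion 1 2 (fun j : Fin n => A (f i) j) ≤
              c₂ * (D ^ 3 * n / (η * Real.sqrt (1 - α) * Real.log n)) ^ ((1 : ℝ) / 2) := by
  refine ⟨10 ^ 6, by norm_num, 1, one_pos, 1 / 8, by norm_num, 10 ^ 6, by norm_num, ?_⟩
  rintro m n - hn A α k D η hα0 hα1 hrank hk hD ⟨K, hK, hrip⟩ hη hE hEk
  classical
  set β := 1 - α with hβ
  set E := (n : ℝ) ^ η with hEdef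
  have hn' : (0 : ℝ) < n := by exact_mod_cast hn
  have hβ0 : 0 < β := by linarith
  have hD0 : 0 < D := by linarith
  have hE0 : 0 < E := Real.rpow_pos_of_pos hn' _
  have hκ : 0 < ⌊k⌋₊ := Nat.floor_pos.2 hk
  have hκk : k ≤ 2 * ⌊k⌋₊ := by
    have h1 := Nat.lt_floor_add_one k
    have h2 : (1 : ℝ) ≤ ⌊k⌋₊ := by exact_mod_cast hκ
    linarith
  have hKnorm : ∀ x : Fin n → ℝ, l2 ((K⁻¹ • A).mulVec x) = K⁻¹ * l2 (A.mulVec x) := fun x => by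
    rw [Matrix.smul_mulVec, l2_smul, abs_of_pos (inv_pos.2 hK)]
  have hA : ∀ x : Fin n → ℝ, (univ.filter fun i => x i ≠ 0).card ≤ ⌊k⌋₊ →
      l2 x ≤ l2 ((K⁻¹ • A).mulVec x) ∧ l2 ((K⁻¹ • A).mulVec x) ≤ D * l2 x := by
    intro x hx
    have h := hrip x ((Nat.cast_le.2 hx).trans (Nat.floor_le (by linarith)))
    rw [pNorm_two, pNorm_two] at h
    rw [hKnorm, inv_mul_eq_div, le_div_iff₀ hK, div_le_iff₀ hK]
    constructor <;> linarith
  have hrank' : ((K⁻¹ • A).rank : ℝ) + β * n = n := by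
    rw [Matrix.rank_smul_of_mem_nonZeroDivisors _
      (mem_nonZeroDivisors_of_ne_zero (inv_ne_zero hK.ne')), hrank, hβ]; ring
  have hkn : ⌊k⌋₊ < n := lt_of_isRIP_of_rank hn hβ0 hrank' fun x hx => (hA x hx).1
  have hkn' : k ≤ n := ((Nat.floor_lt (by linarith)).1 hkn).le
  have hkD : k ^ 2 ≤ D ^ 2 * (n : ℝ) ^ 2 := by
    rw [← mul_pow]
    exact pow_le_pow_left₀ (by linarith) (by nlinarith) 2
  have hEk' : E ≤ k := by
    refine hEk.trans ?_
    rw [div_le_iff₀ (by positivity), one_mul]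
    have h1 : D ^ 2 * (n : ℝ) ^ 2 ≤ D ^ 4 * (n : ℝ) ^ 2 :=
      mul_le_mul_of_nonneg_right (pow_le_pow_right₀ hD (by norm_num)) (sq_nonneg _)
    calc k ^ 3 = k * k ^ 2 := by ring
      _ ≤ k * (D ^ 4 * (n : ℝ) ^ 2) := by gcongr; exact hkD.trans h1
  have hE6 : 10 ^ 6 ≤ E := by
    refine le_trans ?_ hE
    rw [le_div_iff₀ (by positivity)]
    have h1 := one_le_pow₀ hD (n := 8)
    have h2 := pow_le_one₀ hβ0.le (show β ≤ 1 by linarith) (n := 4)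
    linarith
  have hlogE : Real.log E = η * Real.log n := Real.log_rpow hn' η
  have hN : 0 < Real.log E := Real.log_pos (by linarith)
  set X := D ^ 3 * n / (η * √β * Real.log n) with hX
  have hXN : X = D ^ 3 * n / (Real.log E * √β) := by rw [hX, hlogE]; congr 1; ring
  have hX0 : 0 < X := by rw [hXN]; positivity
  set T : Finset (Fin m) :=
    univ.filter fun i => distortion 1 2 (A i) ≤ 10 ^ 6 * X ^ ((1 : ℝ) / 2) with hT
  have hrow : ∀ i, l2 ((K⁻¹ • A) i) ^ 2 = (K⁻¹) ^ 2 * l2 (A i) ^ 2 := fun i => by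
    rw [show (K⁻¹ • A) i = K⁻¹ • A i from rfl, l2_smul, mul_pow, sq_abs]
  have hrow1 : ∀ i, l1 ((K⁻¹ • A) i) ^ 2 = (K⁻¹) ^ 2 * l1 (A i) ^ 2 := fun i => by
    rw [show (K⁻¹ • A) i = K⁻¹ • A i from rfl, l1_smul, mul_pow, sq_abs]
  have hTrow : ∀ i ∉ T, l1 ((K⁻¹ • A) i) ^ 2 <
      Real.log E * √β / (10 ^ 12 * D ^ 3) * l2 ((K⁻¹ • A) i) ^ 2 := by
    intro i hi
    have h1 := l1_sq_lt_of_lt_distortion (x := A i) (by norm_num) hX0.le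
      (not_le.1 fun h => hi (mem_filter.2 ⟨mem_univ i, h⟩))
    have h2 : l1 (A i) ^ 2 < Real.log E * √β / (10 ^ 12 * D ^ 3) * l2 (A i) ^ 2 := by
      rw [hXN, mul_div_assoc', div_mul_eq_mul_div, div_lt_iff₀ (by positivity)] at h1
      rw [div_mul_eq_mul_div, lt_div_iff₀ (by positivity)]
      refine lt_of_mul_lt_mul_right ?_ hn'.le
      linarith
    rw [hrow, hrow1]
    have := mul_lt_mul_of_pos_left h2 (show 0 < (K⁻¹) ^ 2 by positivity)
    linarith
  have hkey := sum_le_mul_sum_of_ratio hn hκ hD hβ0 (by linarith) hE (hEk'.trans hκk) hrank' hA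
    rfl T hTrow
  have hmass := (sum_l2_sq_mem_Icc hκ hA).1
  rw [Fintype.card_fin] at hmass
  have hTn : n ≤ E * ∑ i ∈ T, l2 ((K⁻¹ • A) i) ^ 2 := hmass.trans hkey
  refine ⟨T.card, T.orderEmbOfFin rfl, by simpa using card_le_univ T,
    (T.orderEmbOfFin rfl).injective, ?_, ?_, ?_⟩
  · have hsum : frobNorm (Matrix.of fun (i : Fin T.card) (j : Fin n) =>
        A (T.orderEmbOfFin rfl i) j) ^ 2 = ∑ i ∈ T, l2 (A i) ^ 2 := by
      rw [frobNorm_sq, ← sum_coe_sort T]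
      exact Fintype.sum_equiv (T.orderIsoOfFin rfl).toEquiv _ _ fun i => rfl
    have hKpos : 0 < (K⁻¹) ^ 2 := by positivity
    simp only [hrow, ← mul_sum] at hkey hmass
    have hpos : 0 < ∑ i, l2 (A i) ^ 2 := pos_of_mul_pos_right (hn'.trans_le hmass) hKpos.le
    rw [hsum, frobNorm_sq, ge_iff_le, Real.rpow_neg hn'.le, le_div_iff₀ hpos,
      inv_mul_le_iff₀ hE0]
    refine le_of_mul_le_mul_left ?_ hKpos
    linarith
  · have hrowle : ∀ i ∈ T, l2 ((K⁻¹ • A) i) ^ 2 ≤ 4 * D ^ 2 * n / ⌊k⌋₊ := by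
      intro i _
      rw [le_div_iff₀ (by exact_mod_cast hκ)]
      simpa using l2_row_sq_le hκ (by simpa using hkn.le) hD0.le (fun x hx => (hA x hx).2) i
    have h1 := sum_le_sum hrowle
    rw [sum_const, nsmul_eq_mul] at h1
    have hκ' : (0 : ℝ) < ⌊k⌋₊ := by exact_mod_cast hκ
    have h2 : (n : ℝ) ≤ E * (T.card * (4 * D ^ 2 * n / ⌊k⌋₊)) :=
      hTn.trans (mul_le_mul_of_nonneg_left h1 hE0.le)
    have h3 : k ≤ 8 * D ^ 2 * E * T.card := by
      have h4 : E * (T.card * (4 * D ^ 2 * n / ⌊k⌋₊)) =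
          4 * D ^ 2 * E * T.card * n / ⌊k⌋₊ := by ring
      rw [h4, le_div_iff₀ hκ'] at h2
      have h5 : (⌊k⌋₊ : ℝ) ≤ 4 * D ^ 2 * E * T.card := by
        refine le_of_mul_le_mul_right ?_ hn'
        linarith
      linarith
    rw [ge_iff_le, Real.rpow_add hn', Real.rpow_two, ← hEdef, div_le_iff₀ (by positivity)]
    calc 1 / 8 * k ^ 3 = 1 / 8 * (k * k ^ 2) := by ring
      _ ≤ 1 / 8 * (8 * D ^ 2 * E * T.card * (D ^ 2 * (n : ℝ) ^ 2)) := by gcongr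
      _ = _ := by ring
  · intro i
    exact (mem_filter.1 (T.orderEmbOfFin_mem rfl i)).2
end

section
/- Fix k > 0 and D ≥ 1, let D' > D, and let A ∈ ℝ^{m×n}. If A is (k,D)-ℓ₂-RIP, then A is (k',D')-ℓ₂-ARIP for k' = (D'−D)²·k³ / ((D'D + D' + D)²·n²). -/
open Finset

theorem pNorm_two_eq_norm {ι : Type*} [Fintype ι] (x : ι → ℝ) :
    pNorm 2 x = ‖WithLp.toLp 2 x‖ := by
  rw [EuclideanSpace.norm_eq, Real.sqrt_eq_rpow, pNorm]
  simp [Real.norm_eq_abs]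

theorem pNorm_two_nonneg {ι : Type*} [Fintype ι] (x : ι → ℝ) : 0 ≤ pNorm 2 x := by
  rw [pNorm_two_eq_norm]
  exact norm_nonneg _

theorem pNorm_two_zero {ι : Type*} [Fintype ι] : pNorm 2 (0 : ι → ℝ) = 0 := by
  rw [pNorm_two_eq_norm]
  simp

theorem pNorm_two_sq {ι : Type*} [Fintype ι] (x : ι → ℝ) : pNorm 2 x ^ 2 = ∑ i, x i ^ 2 := by
  rw [pNorm_two_eq_norm, EuclideanSpace.norm_sq_eq]
  simp

theorem pNorm_two_add_le {ι : Type*} [Fintype ι] (x y : ι → ℝ) :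
    pNorm 2 (x + y) ≤ pNorm 2 x + pNorm 2 y := by
  simp only [pNorm_two_eq_norm, WithLp.toLp_add]
  exact norm_add_le _ _

theorem pNorm_two_le_add {ι : Type*} [Fintype ι] (x y : ι → ℝ) :
    pNorm 2 x ≤ pNorm 2 (x + y) + pNorm 2 y := by
  simp only [pNorm_two_eq_norm, WithLp.toLp_add]
  exact norm_le_add_norm_add _ _

theorem pNorm_one_eq {ι : Type*} [Fintype ι] (x : ι → ℝ) : pNorm 1 x = ∑ i, |x i| := by
  simp [pNorm]

theorem pNorm_one_pos {ι : Type*} [Fintype ι] {x : ι → ℝ} (hx : x ≠ 0) : 0 < pNorm 1 x := by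
  obtain ⟨i, hi⟩ := Function.ne_iff.mp hx
  rw [pNorm_one_eq]
  exact sum_pos' (fun i _ => abs_nonneg _) ⟨i, mem_univ i, abs_pos.mpr hi⟩

theorem pNorm_two_sq_le_pNorm_one_sq {ι : Type*} [Fintype ι] (x : ι → ℝ) :
    pNorm 2 x ^ 2 ≤ pNorm 1 x ^ 2 := by
  rw [pNorm_two_sq, pNorm_one_eq]
  simpa using sum_sq_le_sq_sum_of_nonneg (s := univ) (f := fun i => |x i|)
    (fun i _ => abs_nonneg (x i))

/-- A vector of large `(ℓ₁, ℓ₂)`-distortion has small `ℓ₁` norm. -/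
theorem pNorm_one_sq_le_of_le_distortion {ι : Type*} [Fintype ι] {k : ℝ} (hk : 0 < k)
    {x : ι → ℝ} (hx : x ≠ 0)
    (h : ((Fintype.card ι : ℝ) / k) ^ ((1 : ℝ) / 2) ≤ distortion 1 2 x) :
    pNorm 1 x ^ 2 ≤ k * pNorm 2 x ^ 2 := by
  obtain ⟨i, -⟩ := Function.ne_iff.mp hx
  have hn : 0 < (Fintype.card ι : ℝ) := Nat.cast_pos.mpr (Fintype.card_pos_iff.mpr ⟨i⟩)
  have h1 := pNorm_one_pos hx
  have hexp : (1 / 1 - 1 / 2 : ℝ) = 1 / 2 := by norm_num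
  rw [distortion, hexp, ← Real.sqrt_eq_rpow, ← Real.sqrt_eq_rpow] at h
  have h2 := pow_le_pow_left₀ (Real.sqrt_nonneg _) h 2
  rw [Real.sq_sqrt (by positivity), div_pow, mul_pow, Real.sq_sqrt hn.le,
    div_le_div_iff₀ hk (by positivity)] at h2
  nlinarith

/-- The squared `ℓ₂` norm of the restriction of a vector to a set of coordinates. -/
theorem pNorm_two_indicator_sq {ι : Type*} [Fintype ι] (T : Finset ι) (x : ι → ℝ) :
    pNorm 2 ((T : Set ι).indicator x) ^ 2 = ∑ i ∈ T, x i ^ 2 := by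
  classical
  rw [pNorm_two_sq]
  simp [Set.indicator_apply, ite_pow, sum_ite_mem]

theorem isSparse_indicator {ι : Type*} [Fintype ι] {k : ℝ} (T : Finset ι) (hT : (#T : ℝ) ≤ k)
    (x : ι → ℝ) : IsSparse k ((T : Set ι).indicator x) := by
  refine le_trans (Nat.cast_le.mpr (card_le_card fun i hi => ?_)) hT
  by_contra hiT
  simp [hiT] at hi

theorem indicator_add_indicator_sdiff {ι : Type*} [DecidableEq ι] {S T : Finset ι} (hST : S ⊆ T)
    (x : ι → ℝ) :
    (S : Set ι).indicator x + ((T \ S : Finset ι) : Set ι).indicator x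
      = (T : Set ι).indicator x := by
  ext i
  by_cases hS : i ∈ S
  · simp [hS, hST hS]
  · by_cases hT : i ∈ T <;> simp [hS, hT]

/-- A bound `‖Ax‖ ≤ L‖x‖` for `s`-sparse vectors extends, with an extra factor `√b`, to vectors
whose support has at most `b * s` elements. -/
theorem pNorm_two_mulVec_indicator_le {ι κ : Type*} [Fintype ι] [Fintype κ] (A : Matrix ι κ ℝ)
    {L : ℝ} (hL : 0 ≤ L) {s : ℕ} (x : κ → ℝ)
    (hA : ∀ T : Finset κ, #T ≤ s → pNorm 2 (A.mulVec ((T : Set κ).indicator x))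
      ≤ L * pNorm 2 ((T : Set κ).indicator x)) (b : ℕ) (T : Finset κ) (hT : #T ≤ b * s) :
    pNorm 2 (A.mulVec ((T : Set κ).indicator x))
      ≤ L * (√b * pNorm 2 ((T : Set κ).indicator x)) := by
  classical
  induction b generalizing T with
  | zero =>
    obtain rfl : T = ∅ := by simpa using hT
    simp [pNorm_two_zero, show (fun _ : κ => (0 : ℝ)) = 0 from rfl]
  | succ b ih =>
    obtain ⟨S, hST, hS⟩ := exists_subset_card_eq (min_le_left #T s)
    have hS' : #S ≤ s := hS ▸ min_le_right _ _
    have hR : #(T \ S) ≤ b * s := by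
      rw [card_sdiff_of_subset hST, hS]
      rw [Nat.succ_mul] at hT
      omega
    have h1 := hA S hS'
    have h2 := ih (T \ S) hR
    have h3 := pNorm_two_add_le (A.mulVec ((S : Set κ).indicator x))
      (A.mulVec (((T \ S : Finset κ) : Set κ).indicator x))
    rw [← Matrix.mulVec_add, indicator_add_indicator_sdiff hST] at h3
    have hsq : pNorm 2 ((T : Set κ).indicator x) ^ 2 = pNorm 2 ((S : Set κ).indicator x) ^ 2
        + pNorm 2 (((T \ S : Finset κ) : Set κ).indicator x) ^ 2 := by
      simp only [pNorm_two_indicator_sq]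
      rw [add_comm, sum_sdiff hST]
    set p := pNorm 2 ((S : Set κ).indicator x)
    set q := pNorm 2 (((T \ S : Finset κ) : Set κ).indicator x)
    have hb : √(b : ℝ) ^ 2 = b := Real.sq_sqrt (Nat.cast_nonneg b)
    have key : p + √b * q ≤ √((b + 1 : ℕ) : ℝ) * pNorm 2 ((T : Set κ).indicator x) := by
      refine le_of_sq_le_sq ?_ (mul_nonneg (Real.sqrt_nonneg _) (pNorm_two_nonneg _))
      rw [mul_pow, hsq, Real.sq_sqrt (Nat.cast_nonneg _)]
      push_cast
      nlinarith [sq_nonneg (√b * p - q)]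
    nlinarith [mul_le_mul_of_nonneg_left key hL]

/-- Every vector agrees with a restriction to `s = ⌊k⌋` coordinates up to an error of `ℓ₂` norm
at most `‖x‖₁ / √k`. -/
theorem exists_card_eq_pNorm_two_indicator_compl_sq_le {ι : Type*} [Fintype ι] [DecidableEq ι]
    {k : ℝ} (hk : 0 < k) (hkn : k < Fintype.card ι) (x : ι → ℝ) (hx : x ≠ 0) :
    ∃ S : Finset ι, #S = ⌊k⌋₊ ∧
      k * pNorm 2 (((univ \ S : Finset ι) : Set ι).indicator x) ^ 2 ≤ pNorm 1 x ^ 2 := by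
  have h1 := pNorm_one_pos hx
  set S₀ : Finset ι := {i | pNorm 1 x < k * |x i|}
  have hS₀ : #S₀ ≤ ⌊k⌋₊ := by
    refine Nat.le_floor ?_
    have h2 : (#S₀ : ℝ) * pNorm 1 x ≤ k * pNorm 1 x := calc
      (#S₀ : ℝ) * pNorm 1 x = ∑ i ∈ S₀, pNorm 1 x := by simp
      _ ≤ ∑ i ∈ S₀, k * |x i| := sum_le_sum fun i hi => (mem_filter.mp hi).2.le
      _ ≤ ∑ i, k * |x i| :=
        sum_le_sum_of_subset_of_nonneg (subset_univ _) fun i _ _ => by positivity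
      _ = k * pNorm 1 x := by rw [pNorm_one_eq, mul_sum]
    exact le_of_mul_le_mul_right h2 h1
  have hcard : ⌊k⌋₊ ≤ #(univ : Finset ι) := Nat.floor_le_of_le hkn.le
  obtain ⟨S, hS, -, hSc⟩ := exists_subsuperset_card_eq (subset_univ S₀) hS₀ hcard
  refine ⟨S, hSc, ?_⟩
  rw [pNorm_two_indicator_sq, mul_sum]
  calc ∑ i ∈ univ \ S, k * x i ^ 2 ≤ ∑ i ∈ univ \ S, pNorm 1 x * |x i| := by
        refine sum_le_sum fun i hi => ?_
        have hi' : k * |x i| ≤ pNorm 1 x := by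
          by_contra! hlt
          exact (mem_sdiff.mp hi).2 (hS (mem_filter.mpr ⟨mem_univ i, hlt⟩))
        rw [← sq_abs]
        nlinarith [abs_nonneg (x i)]
    _ ≤ ∑ i, pNorm 1 x * |x i| :=
        sum_le_sum_of_subset_of_nonneg (subset_univ _) fun i _ _ => by positivity
    _ = pNorm 1 x ^ 2 := by rw [← mul_sum, ← pNorm_one_eq, sq]

/-- The complement of `⌊k⌋` among `n` elements splits into `b ≤ n² / k²` blocks of size at most
`⌊k⌋`. -/
theorem exists_block_count {k : ℝ} (hk : 1 ≤ k) {n : ℕ} (hkn : k < n) :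
    ∃ b : ℕ, 1 ≤ b ∧ n - ⌊k⌋₊ ≤ b * ⌊k⌋₊ ∧ (b : ℝ) * k ^ 2 ≤ (n : ℝ) ^ 2 := by
  have hs : 1 ≤ ⌊k⌋₊ := Nat.le_floor (by simpa using hk)
  have hsn : ⌊k⌋₊ < n := (Nat.floor_lt (by linarith)).mpr hkn
  have hks : k < ⌊k⌋₊ + 1 := Nat.lt_floor_add_one k
  set s := ⌊k⌋₊
  refine ⟨(n - 1) / s, (Nat.one_le_div_iff hs).mpr (by omega), ?_, ?_⟩
  · have h1 := Nat.lt_div_mul_add (a := n - 1) hs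
    omega
  · have h2 : (((n - 1) / s : ℕ) : ℝ) * s ≤ n - 1 := by
      have := Nat.div_mul_le_self (n - 1) s
      have h3 : (((n - 1) / s * s : ℕ) : ℝ) ≤ ((n - 1 : ℕ) : ℝ) := Nat.cast_le.mpr this
      rwa [Nat.cast_mul, Nat.cast_sub (by omega), Nat.cast_one] at h3
    have hs' : (1 : ℝ) ≤ s := by exact_mod_cast hs
    have hsn' : (s : ℝ) + 1 ≤ n := by exact_mod_cast hsn
    refine le_of_mul_le_mul_right ?_ (by linarith : (0 : ℝ) < s)
    have h4 : k ^ 2 ≤ (s + 1 : ℝ) ^ 2 := pow_le_pow_left₀ (by linarith) hks.le 2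
    have h5 : 0 ≤ (s * ((n : ℝ) - 1) - 1) * ((n : ℝ) - 1 - s) :=
      mul_nonneg (by nlinarith) (by linarith)
    calc (((n - 1) / s : ℕ) : ℝ) * k ^ 2 * s = (((n - 1) / s : ℕ) : ℝ) * s * k ^ 2 := by ring
      _ ≤ ((n : ℝ) - 1) * (s + 1 : ℝ) ^ 2 := by gcongr; linarith
      _ ≤ (n : ℝ) ^ 2 * s := by nlinarith

/-- If `A` is `(k, D)`-ℓ₂-RIP and `D' > D`, then `A` is `(k', D')`-ℓ₂-ARIP for
`k' = (D'-D)²k³/((D'D + D' + D)²n²)`. -/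
theorem rip_imp_arip {m n : ℕ} (A : Matrix (Fin m) (Fin n) ℝ) (k D D' : ℝ)
    (hk : 0 < k) (hD : 1 ≤ D) (hD' : D < D') (h : IsRIP 2 A k D) :
    IsARIP A ((D' - D) ^ 2 * k ^ 3 / ((D' * D + D' + D) ^ 2 * (n : ℝ) ^ 2)) D' := by
  obtain ⟨K, hK, hA⟩ := h
  have hE : 0 < D' * D + D' + D := by nlinarith
  rcases le_or_gt (n : ℝ) k with hnk | hkn
  · refine ⟨K, hK, fun x _ => ?_⟩
    have hx : IsSparse k x :=
      le_trans (Nat.cast_le.mpr ((card_le_univ _).trans_eq (Fintype.card_fin n))) hnk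
    refine ⟨(hA x hx).1, (hA x hx).2.trans ?_⟩
    have := pNorm_two_nonneg x
    gcongr
  have hn : (0 : ℝ) < n := hk.trans hkn
  set c : ℝ := (D' - D) / (D' * D + D' + D) with hc
  have hc0 : 0 < c := div_pos (by linarith) hE
  have hcE : c * (D' * D + D' + D) = D' - D := div_mul_cancel₀ _ hE.ne'
  have hcD : c * (1 + D) < 1 := by
    rw [hc, div_mul_eq_mul_div, div_lt_one hE]
    nlinarith
  have hk' : (D' - D) ^ 2 * k ^ 3 / ((D' * D + D' + D) ^ 2 * (n : ℝ) ^ 2)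
      = c ^ 2 * k ^ 3 / (n : ℝ) ^ 2 := by
    rw [hc]
    field_simp
  rw [hk']
  have hk'pos : 0 < c ^ 2 * k ^ 3 / (n : ℝ) ^ 2 := by positivity
  refine ⟨K * (1 - c * (1 + D)), mul_pos hK (by linarith), fun x hx => ?_⟩
  rcases eq_or_ne x 0 with rfl | hx0
  · simp [pNorm_two_zero]
  have hx1 := pNorm_one_sq_le_of_le_distortion hk'pos hx0 hx
  have hk1 : 1 ≤ k := by
    by_contra! hk1
    have h1 := pNorm_two_sq_le_pNorm_one_sq x
    have h2 := pow_pos (pNorm_one_pos hx0) 2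
    have hn1 : (1 : ℝ) ≤ n := by exact_mod_cast Nat.cast_pos.mp hn
    have hlt : c ^ 2 * k ^ 3 / (n : ℝ) ^ 2 < 1 := by
      rw [div_lt_one (by positivity)]
      have hc1 : c ^ 2 ≤ 1 := pow_le_one₀ hc0.le (by nlinarith)
      have hk3 : k ^ 3 < 1 := pow_lt_one₀ hk.le hk1 (by norm_num)
      nlinarith [pow_pos hk 3]
    nlinarith
  obtain ⟨S, hS, hSx⟩ := exists_card_eq_pNorm_two_indicator_compl_sq_le hk
    (by simpa using hkn) x hx0
  obtain ⟨b, hb1, hb, hbk⟩ := exists_block_count hk1 hkn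
  have hsparse : ∀ T : Finset (Fin n), #T ≤ ⌊k⌋₊ → IsSparse k ((T : Set (Fin n)).indicator x) :=
    fun T hT => isSparse_indicator T ((Nat.le_floor_iff hk.le).mp hT) x
  have htail := pNorm_two_mulVec_indicator_le A (by positivity : 0 ≤ D * K) x
    (fun T hT => (hA _ (hsparse T hT)).2) b (univ \ S)
    (by rwa [card_sdiff_of_subset (subset_univ S), card_univ, Fintype.card_fin, hS])
  have hhead := hA _ (hsparse S hS.le)
  have hsplit := indicator_add_indicator_sdiff (subset_univ S) x
  rw [coe_univ, Set.indicator_univ] at hsplit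
  have hsq : pNorm 2 x ^ 2 = pNorm 2 ((S : Set (Fin n)).indicator x) ^ 2
      + pNorm 2 (((univ \ S : Finset (Fin n)) : Set (Fin n)).indicator x) ^ 2 := by
    rw [pNorm_two_indicator_sq, pNorm_two_indicator_sq, pNorm_two_sq, add_comm,
      sum_sdiff (subset_univ S)]
  have hup := pNorm_two_add_le (A.mulVec ((S : Set (Fin n)).indicator x))
    (A.mulVec (((univ \ S : Finset (Fin n)) : Set (Fin n)).indicator x))
  have hlow := pNorm_two_le_add (A.mulVec ((S : Set (Fin n)).indicator x))
    (A.mulVec (((univ \ S : Finset (Fin n)) : Set (Fin n)).indicator x))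
  have htri := pNorm_two_add_le ((S : Set (Fin n)).indicator x)
    (((univ \ S : Finset (Fin n)) : Set (Fin n)).indicator x)
  rw [← Matrix.mulVec_add, hsplit] at hup hlow
  rw [hsplit] at htri
  have hN := pNorm_two_nonneg x
  have hp := pNorm_two_nonneg ((S : Set (Fin n)).indicator x)
  have hq := pNorm_two_nonneg (((univ \ S : Finset (Fin n)) : Set (Fin n)).indicator x)
  set N := pNorm 2 x
  set p := pNorm 2 ((S : Set (Fin n)).indicator x)
  set q := pNorm 2 (((univ \ S : Finset (Fin n)) : Set (Fin n)).indicator x)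
  have hpN : p ≤ N := le_of_sq_le_sq (by nlinarith [sq_nonneg q]) hN
  have hqσ : q ≤ √b * q :=
    le_mul_of_one_le_left hq (Real.one_le_sqrt.mpr (by exact_mod_cast hb1))
  have hσ : √b * q ≤ c * N := by
    refine le_of_sq_le_sq ?_ (mul_nonneg hc0.le hN)
    rw [mul_pow, mul_pow, Real.sq_sqrt (Nat.cast_nonneg b)]
    have hq2 : q ^ 2 ≤ c ^ 2 * k ^ 2 / (n : ℝ) ^ 2 * N ^ 2 := by
      refine le_of_mul_le_mul_left ((hSx.trans hx1).trans_eq ?_) hk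
      ring
    calc (b : ℝ) * q ^ 2 ≤ b * (c ^ 2 * k ^ 2 / (n : ℝ) ^ 2 * N ^ 2) := by gcongr
      _ = c ^ 2 * N ^ 2 * (b * k ^ 2 / (n : ℝ) ^ 2) := by ring
      _ ≤ c ^ 2 * N ^ 2 * 1 := by
        gcongr
        exact (div_le_one (by positivity)).mpr hbk
      _ = c ^ 2 * N ^ 2 := mul_one _
  have hDK : 0 < D * K := by positivity
  have hσD := mul_le_mul_of_nonneg_left hσ hDK.le
  constructor
  · have h1 : K * ((1 - c) * N) ≤ K * p := by gcongr; linarith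
    linarith [hhead.1]
  · have h1 : D * K * p ≤ D * K * N := by gcongr
    have h2 : D' * (K * (1 - c * (1 + D))) = D * K * (1 + c) := by
      linear_combination -K * hcE
    rw [h2]
    linarith [hhead.2]
end

section
/- Fix 1 ≤ q < p, integers 1 ≤ k ≤ n, ε > 0, and a nonzero vector x ∈ ℝⁿ. If x is (k,ε)-ℓ_p-compressible, then Δ_{q,p}(x) ≥ 1 / ((k/n)^{1/q − 1/p} + ε). -/
open Finset

/-- A nonzero vector `x ∈ ℝⁿ` is `(k, ε)`-ℓ_p-compressible if there is a `k`-sparse `y` with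
`‖x - y‖_p ≤ ε‖x‖_p`. -/
def IsCompressible (p : ℝ) {ι : Type*} [Fintype ι] (k : ℕ) (ε : ℝ) (x : ι → ℝ) : Prop :=
  ∃ y : ι → ℝ, (Finset.univ.filter (fun i => y i ≠ 0)).card ≤ k ∧
    pNorm p (fun i => x i - y i) ≤ ε * pNorm p x

lemma pNorm_nonneg {ι : Type*} [Fintype ι] (p : ℝ) (x : ι → ℝ) : 0 ≤ pNorm p x :=
  Real.rpow_nonneg (sum_nonneg fun _ _ => Real.rpow_nonneg (abs_nonneg _) _) _

lemma pNorm_pos {ι : Type*} [Fintype ι] (p : ℝ) {x : ι → ℝ} (hx : x ≠ 0) : 0 < pNorm p x := by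
  obtain ⟨i, hi⟩ := Function.ne_iff.mp hx
  exact Real.rpow_pos_of_pos (sum_pos' (fun _ _ => Real.rpow_nonneg (abs_nonneg _) _)
    ⟨i, mem_univ i, Real.rpow_pos_of_pos (abs_pos.mpr hi) _⟩) _

lemma pNorm_mono {ι : Type*} [Fintype ι] {p : ℝ} (hp : 0 ≤ p) {x z : ι → ℝ}
    (h : ∀ i, |x i| ≤ |z i|) : pNorm p x ≤ pNorm p z :=
  Real.rpow_le_rpow (sum_nonneg fun _ _ => Real.rpow_nonneg (abs_nonneg _) _)
    (sum_le_sum fun i _ => Real.rpow_le_rpow (abs_nonneg _) (h i) hp) (one_div_nonneg.mpr hp)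

lemma pNorm_add_le {ι : Type*} [Fintype ι] {p : ℝ} (hp : 1 ≤ p) (x z : ι → ℝ) :
    pNorm p (fun i => x i + z i) ≤ pNorm p x + pNorm p z :=
  Real.Lp_add_le univ x z hp

/-- Comparison of `ℓ_q` and `ℓ_p` norms for vectors supported on a set `s`. -/
lemma pNorm_le_card_rpow_mul_pNorm {ι : Type*} [Fintype ι] {q p : ℝ} (hq : 0 < q) (hqp : q ≤ p)
    (s : Finset ι) (x : ι → ℝ) (hx : ∀ i ∉ s, x i = 0) :
    pNorm q x ≤ (s.card : ℝ) ^ (1 / q - 1 / p) * pNorm p x := by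
  have hp : 0 < p := hq.trans_le hqp
  have hsum : ∀ r : ℝ, 0 < r → ∑ i, |x i| ^ r = ∑ i ∈ s, |x i| ^ r := fun r hr =>
    (sum_subset (subset_univ s) fun i _ hi => by simp [hx i hi, hr.ne']).symm
  have hS : ∀ r : ℝ, 0 ≤ ∑ i ∈ s, |x i| ^ r := fun r =>
    sum_nonneg fun _ _ => Real.rpow_nonneg (abs_nonneg _) _
  have h := Real.rpow_sum_le_const_mul_sum_rpow s (fun i => |x i| ^ q)
    ((one_le_div hq).mpr hqp)
  have hpow : ∀ i, |(|x i| ^ q)| ^ (p / q) = |x i| ^ p := fun i => by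
    rw [abs_of_nonneg (Real.rpow_nonneg (abs_nonneg _) _), ← Real.rpow_mul (abs_nonneg _),
      mul_div_cancel₀ _ hq.ne']
  simp only [hpow] at h
  simp only [abs_of_nonneg (Real.rpow_nonneg (abs_nonneg _) _)] at h
  have h' := Real.rpow_le_rpow (Real.rpow_nonneg (hS q) _) h (one_div_nonneg.mpr hp.le)
  rw [← Real.rpow_mul (hS q), Real.mul_rpow (by positivity) (hS p),
    ← Real.rpow_mul (Nat.cast_nonneg _)] at h'
  rw [pNorm, pNorm, hsum q hq, hsum p hp]
  convert h' using 3 <;> field_simp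

/-- If `1 ≤ q < p`, `1 ≤ k ≤ n`, `ε > 0` and a nonzero `x ∈ ℝⁿ` is `(k, ε)`-ℓ_p-compressible,
then `Δ_{q,p}(x) ≥ 1/((k/n)^{1/q - 1/p} + ε)`. -/
theorem compressible_imp_distorted {n : ℕ} (q p : ℝ) (hq : 1 ≤ q) (hqp : q < p)
    (k : ℕ) (hk : 1 ≤ k) (hkn : k ≤ n) (ε : ℝ) (hε : 0 < ε)
    (x : Fin n → ℝ) (hx : x ≠ 0) (h : IsCompressible p k ε x) :
    distortion q p x ≥ 1 / (((k : ℝ) / n) ^ (1 / q - 1 / p) + ε) := by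
  obtain ⟨y, hy, hxy⟩ := h
  have hq0 : 0 < q := by linarith
  have hp0 : 0 < p := by linarith
  have hn : (0 : ℝ) < n := by exact_mod_cast hk.trans hkn
  have ha : 0 ≤ 1 / q - 1 / p := sub_nonneg.mpr (one_div_le_one_div_of_le hq0 hqp.le)
  set a := 1 / q - 1 / p with ha_def
  set u : Fin n → ℝ := fun i => if y i ≠ 0 then x i else 0 with hu
  set v : Fin n → ℝ := fun i => if y i ≠ 0 then 0 else x i with hv
  have hxuv : x = fun i => u i + v i := by
    funext i
    by_cases hi : y i = 0 <;> simp [hu, hv, hi]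
  have hu_le : pNorm q u ≤ (k : ℝ) ^ a * pNorm p x := by
    refine (pNorm_le_card_rpow_mul_pNorm hq0 hqp.le (univ.filter fun i => y i ≠ 0) u
      (by simp +contextual [hu])).trans (mul_le_mul ?_ ?_ (pNorm_nonneg _ _) (by positivity))
    · exact Real.rpow_le_rpow (Nat.cast_nonneg _) (by exact_mod_cast hy) ha
    · refine pNorm_mono hp0.le fun i => ?_
      by_cases hi : y i = 0 <;> simp [hu, hi]
  have hv_le : pNorm q v ≤ (n : ℝ) ^ a * (ε * pNorm p x) := by
    have hcard := pNorm_le_card_rpow_mul_pNorm hq0 hqp.le univ v (by simp)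
    rw [card_univ, Fintype.card_fin] at hcard
    refine hcard.trans (mul_le_mul_of_nonneg_left (le_trans ?_ hxy) (by positivity))
    refine pNorm_mono hp0.le fun i => ?_
    by_cases hi : y i = 0 <;> simp [hv, hi]
  have hx_le : pNorm q x ≤ (k : ℝ) ^ a * pNorm p x + (n : ℝ) ^ a * (ε * pNorm p x) :=
    calc pNorm q x = pNorm q (fun i => u i + v i) := congrArg _ hxuv
      _ ≤ pNorm q u + pNorm q v := pNorm_add_le hq u v
      _ ≤ _ := add_le_add hu_le hv_le
  have hna : (0 : ℝ) < (n : ℝ) ^ a := Real.rpow_pos_of_pos hn a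
  rw [ge_iff_le, distortion, Fintype.card_fin, div_le_div_iff₀ (by positivity) (pNorm_pos q hx),
    one_mul, Real.div_rpow (Nat.cast_nonneg _) hn.le]
  refine hx_le.trans_eq ?_
  rw [← ha_def]
  field_simp
end
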